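/- There exists a universal constant c > 0 such that the following holds. Let k ≥ 2 and N be such that 16·8^k ≤ N, and let U ∈ ℝ^{N×N} be a good orthogonal matrix. Let F be a randomized decision tree of depth at most d over kN variables (a probability distribution over deterministic decision trees of depth at most d, each computing a function {-1,1}^{kN} → {0,1}) that solves the k-fold Rorrelation problem with respect to U with success probability at least 2/3; that is: for every z ∈ ({-1,1}^N)^k with φ_U(z) ≥ 2^{-k}, Pr[F(z) = 1] ≥ 2/3, and for every z ∈ ({-1,1}^N)^k with |φ_U(z)| ≤ 2^{-(k+1)}, Pr[F(z) = 0] ≥ 2/3 (probabilities over the random choice of tree). Then d ≥ c · N^{2(k-1)/(3k-1)} / (k·ln(kN)). -/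

import Mathlib

open scoped BigOperators


/-- A deterministic decision tree over variables indexed by `α`:
each internal node queries a variable (the first subtree is followed when the
variable equals `-1`, i.e. `false`, the second when it equals `1`, i.e. `true`),
and each leaf is labeled by `0` or `1` (encoded as a `Bool`). -/
inductive DTree (α : Type) : Type where
  | leaf : Bool → DTree α
  | node : α → DTree α → DTree α → DTree α

namespace DTree

/-- Evaluation of a decision tree on an input in `{-1,1}^α`, encoded as a
function `α → Bool` (`true` stands for `1`, `false` for `-1`); the output
`{0,1}` is given as a real number. -/
def eval {α : Type} : DTree α → (α → Bool) → ℝ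
  | leaf b, _ => if b then 1 else 0
  | node i t0 t1, x => if x i then t1.eval x else t0.eval x

/-- Depth of a decision tree: the maximal number of internal nodes on a
root-to-leaf path. -/
def depth {α : Type} : DTree α → ℕ
  | leaf _ => 0
  | node _ t0 t1 => 1 + max t0.depth t1.depth

end DTree

/-- The Fourier coefficient `f̂(S) = 2^{-n} ∑_{x ∈ {-1,1}^n} f(x) ∏_{i ∈ S} x_i`,
for `f` on `{-1,1}^α` encoded as a function on `α → Bool`. -/
noncomputable def booleanFourierCoeff {α : Type} [Fintype α] [DecidableEq α]
    (f : (α → Bool) → ℝ) (S : Finset α) : ℝ :=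
  (∑ x : α → Bool, f x * ∏ i ∈ S, (if x i then (1 : ℝ) else -1)) / 2 ^ Fintype.card α

/-- The average of `f` over the uniform distribution on `{-1,1}^α`;
for `{0,1}`-valued `f` this is `Pr[f(x) = 1]`. -/
noncomputable def uavg {α : Type} [Fintype α] [DecidableEq α]
    (f : (α → Bool) → ℝ) : ℝ :=
  (∑ x : α → Bool, f x) / 2 ^ Fintype.card α


/-- `U : Fin N → Fin N → ℝ` (viewed as an `N × N` real matrix `U i j`) is
orthogonal: its columns and its rows are orthonormal. -/
def IsOrthogonal {N : ℕ} (U : Fin N → Fin N → ℝ) : Prop :=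
  (∀ j₁ j₂ : Fin N, ∑ i, U i j₁ * U i j₂ = if j₁ = j₂ then (1 : ℝ) else 0) ∧
  (∀ i₁ i₂ : Fin N, ∑ j, U i₁ j * U i₂ j = if i₁ = i₂ then (1 : ℝ) else 0)

/-- The `k`-fold Rorrelation of the vectors `z 0, …, z (k-1)` in `ℝ^N` with
respect to the matrix `U`:
`φ_U(z) = (1/N) ∑_{i₁,…,i_k} z^{(1)}_{i₁} U_{i₁ i₂} z^{(2)}_{i₂} ⋯ U_{i_{k-1} i_k} z^{(k)}_{i_k}`. -/
noncomputable def phiU (N k : ℕ) (U : Fin N → Fin N → ℝ)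
    (z : Fin k → Fin N → ℝ) : ℝ :=
  (1 / N) * ∑ i : Fin k → Fin N,
    (∏ a : Fin k, z a (i a)) *
      ∏ b : Fin (k - 1),
        U (i ⟨b.val, lt_of_lt_of_le b.isLt (Nat.sub_le k 1)⟩)
          (i ⟨b.val + 1, by have := b.isLt; omega⟩)

/-- The operator (spectral) norm of a real matrix `A` (given as a function):
`‖A‖ = sup_{x ≠ 0} ‖Ax‖₂ / ‖x‖₂` (and `0` if the index types are empty). -/
noncomputable def opNorm {m n : Type} [Fintype m] [Fintype n]
    (A : m → n → ℝ) : ℝ :=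
  sSup {r : ℝ | ∃ x : n → ℝ, x ≠ 0 ∧
    r = Real.sqrt (∑ i, (∑ j, A i j * x j) ^ 2) / Real.sqrt (∑ j, x j ^ 2)}

/-- The operator norm of the submatrix `U_{S,T}` of `U` with rows indexed by
`S` and columns indexed by `T`. -/
noncomputable def subOpNorm {N : ℕ} (U : Fin N → Fin N → ℝ)
    (S T : Finset (Fin N)) : ℝ :=
  opNorm (fun (i : {a // a ∈ S}) (j : {a // a ∈ T}) => U i.val j.val)

/-- An orthogonal matrix `U ∈ ℝ^{N×N}` is *good* if every nonempty submatrix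
`U_{S,T}` satisfies `‖U_{S,T}‖ ≤ √(100·(|S|+|T|)·ln N / N)`. -/
def IsGood {N : ℕ} (U : Fin N → Fin N → ℝ) : Prop :=
  ∀ S T : Finset (Fin N), S.Nonempty → T.Nonempty →
    subOpNorm U S T ≤ Real.sqrt (100 * (S.card + T.card) * Real.log N / N)


open MeasureTheory

namespace Ror

noncomputable def kap (t : ℝ) : ℝ := t / √(1/10000 + t^2)
noncomputable def kapd (t : ℝ) : ℝ := (1/10000) / ((1/10000 + t^2) * √(1/10000 + t^2))
noncomputable def Kk (t : ℝ) : ℝ := √(1/10000 + 1) - √(1/10000 + t^2)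

lemma apos (t : ℝ) : (0:ℝ) < 1/10000 + t^2 := by positivity
lemma spos (t : ℝ) : (0:ℝ) < √(1/10000 + t^2) := Real.sqrt_pos.2 (apos t)
lemma ssq (t : ℝ) : √(1/10000 + t^2) ^ 2 = 1/10000 + t^2 := Real.sq_sqrt (apos t).le

lemma sge (t : ℝ) : |t| ≤ √(1/10000 + t^2) := by
  apply Real.abs_le_sqrt; linarith

lemma sge' (t : ℝ) : 1/100 ≤ √(1/10000 + t^2) := by
  apply Real.le_sqrt_of_sq_le; nlinarith [sq_nonneg t]

lemma kap_abs (t : ℝ) : |kap t| ≤ 1 := by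
  unfold kap
  rw [abs_div, abs_of_pos (spos t), div_le_one (spos t)]
  exact sge t

lemma kap_neg (t : ℝ) : kap (-t) = - kap t := by
  unfold kap; rw [neg_sq]; ring

lemma kap_cont : Continuous kap := by
  unfold kap
  exact continuous_id.div (by fun_prop) (fun t => (spos t).ne')

lemma kapd_cont : Continuous kapd := by
  unfold kapd
  exact continuous_const.div (by fun_prop) (fun t => (mul_pos (apos t) (spos t)).ne')

lemma Kk_cont : Continuous Kk := by
  unfold Kk; fun_prop

lemma sqrt_deriv (t : ℝ) : HasDerivAt (fun t : ℝ => √(1/10000 + t^2)) (kap t) t := by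
  have h1 : HasDerivAt (fun t : ℝ => 1/10000 + t^2) (2 * t) t := by
    simpa using ((hasDerivAt_id t).pow 2).const_add (1/10000:ℝ)
  have := h1.sqrt (apos t).ne'
  convert this using 1
  unfold kap
  have := (spos t).ne'
  field_simp

lemma Kk_deriv (t : ℝ) : HasDerivAt Kk (- kap t) t := by
  unfold Kk
  exact (sqrt_deriv t).const_sub _

lemma kap_deriv (t : ℝ) : HasDerivAt kap (kapd t) t := by
  have := (hasDerivAt_id t).div (sqrt_deriv t) (spos t).ne'
  have h2 : (1 * √(1/10000 + t^2) - id t * kap t) / √(1/10000 + t^2) ^ 2 = kapd t := by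
    unfold kapd kap
    have h := spos t
    have h' := apos t
    have h3 := ssq t
    simp only [id]
    generalize √(1/10000 + t^2) = s at *
    rw [← h3]
    have h4 : (1:ℝ) * s - t * (t / s) = (1/10000) / s := by
      rw [eq_div_iff h.ne']
      have : (1 * s - t * (t / s)) * s = s^2 - t^2 * (s / s) := by ring
      rw [this, div_self h.ne', h3]; ring
    rw [h4, div_div]
    ring
  rw [h2] at this
  exact this

lemma kapd_nonneg (t : ℝ) : 0 ≤ kapd t := by
  unfold kapd; have := spos t; have := apos t; positivity

lemma kapd_le (t : ℝ) : kapd t ≤ 100 := by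
  unfold kapd
  rw [div_le_iff₀ (mul_pos (apos t) (spos t))]
  have h1 := sge' t
  have h2 : (1/10000:ℝ) ≤ 1/10000 + t^2 := by nlinarith [sq_nonneg t]
  have := mul_le_mul h2 h1 (by norm_num) (by positivity)
  linarith

lemma Kk_one : Kk 1 = 0 := by unfold Kk; norm_num
lemma Kk_neg_one : Kk (-1) = 0 := by unfold Kk; norm_num

lemma Kk_nonneg {t : ℝ} (h : |t| ≤ 1) : 0 ≤ Kk t := by
  unfold Kk
  rw [sub_nonneg]
  apply Real.sqrt_le_sqrt
  have : t^2 ≤ 1 := by rw [sq_le_one_iff_abs_le_one]; exact h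
  linarith

lemma Kk_le (t : ℝ) : Kk t ≤ 1 := by
  unfold Kk
  have h1 := sge' t
  have : √(1/10000 + 1) ≤ (1.005:ℝ) := by
    rw [Real.sqrt_le_left (by norm_num)]; norm_num
  linarith

lemma tkap (t : ℝ) : |t| - 1/100 ≤ t * kap t := by
  have h1 := sge t
  have h2 := sge' t
  have h3 := ssq t
  have h4 := spos t
  unfold kap
  rw [← mul_div_assoc, le_div_iff₀ h4]
  have h5 : t * t = |t| * |t| := (abs_mul_abs_self t).symm
  set s := √(1/10000 + t^2)
  have h6 : |t| * |t| = s^2 - 1/10000 := by rw [h3, ← h5]; ring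
  rw [h5, h6]
  nlinarith

/-- uniform measure on [-1,1] -/
noncomputable def mu0 : Measure ℝ := (1/2 : ENNReal) • volume.restrict (Set.Icc (-1:ℝ) 1)

instance : IsProbabilityMeasure mu0 := by
  constructor
  unfold mu0
  simp
  norm_num
  exact ENNReal.inv_mul_cancel (by norm_num) (by norm_num)

lemma mu0_int (f : ℝ → ℝ) : ∫ t, f t ∂mu0 = (1/2) * ∫ t in (-1:ℝ)..1, f t := by
  unfold mu0
  rw [integral_smul_measure, intervalIntegral.integral_of_le (by norm_num), integral_Icc_eq_integral_Ioc]
  simp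

lemma mu0_ae : ∀ᵐ t ∂mu0, |t| ≤ 1 := by
  unfold mu0
  apply Measure.ae_smul_measure
  rw [ae_restrict_iff' measurableSet_Icc]
  filter_upwards with t ht
  exact abs_le.2 ht

lemma mu0_integrable {f : ℝ → ℝ} (hf : Continuous f) : Integrable f mu0 := by
  unfold mu0
  exact (hf.integrableOn_Icc).smul_measure (by norm_num)

lemma mu0_odd (f : ℝ → ℝ) (hf : ∀ t, f (-t) = - f t) : ∫ t, f t ∂mu0 = 0 := by
  rw [mu0_int]
  have h : ∫ t in (-1:ℝ)..1, f (-t) = ∫ t in (-1:ℝ)..1, f t := by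
    rw [intervalIntegral.integral_comp_neg]; simp
  simp_rw [hf] at h
  rw [intervalIntegral.integral_neg] at h
  linarith

lemma mu0_kap : ∫ t, kap t ∂mu0 = 0 := mu0_odd _ kap_neg
lemma mu0_kap3 : ∫ t, kap t ^ 3 ∂mu0 = 0 := mu0_odd _ (fun t => by rw [kap_neg]; ring)

noncomputable def sig2 : ℝ := ∫ t, kap t ^ 2 ∂mu0

lemma sig2_le : sig2 ≤ 1 := by
  unfold sig2
  calc ∫ t, kap t ^ 2 ∂mu0 ≤ ∫ t, (1:ℝ) ∂mu0 := by
        apply integral_mono (mu0_integrable (kap_cont.pow 2)) (by simp)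
        intro t
        have := kap_abs t
        simpa [sq_le_one_iff_abs_le_one] using this
    _ = 1 := by simp

lemma mu0_kap4 : ∫ t, kap t ^ 4 ∂mu0 ≤ 1 := by
  calc ∫ t, kap t ^ 4 ∂mu0 ≤ ∫ t, (1:ℝ) ∂mu0 := by
        apply integral_mono (mu0_integrable (kap_cont.pow 4)) (by simp)
        intro t
        have := kap_abs t
        have h2 : kap t ^ 2 ≤ 1 := by rwa [sq_le_one_iff_abs_le_one]
        show kap t ^ 4 ≤ 1
        nlinarith [sq_nonneg (kap t)]
    _ = 1 := by simp

lemma sig2_nonneg : 0 ≤ sig2 := integral_nonneg (fun t => sq_nonneg _)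

lemma sig2_ge : 98/100 ≤ sig2 := by
  have hd : ∀ t : ℝ, HasDerivAt (fun t : ℝ => t - (1/100) * Real.arctan (100 * t)) (kap t ^ 2) t := by
    intro t
    have h1 : HasDerivAt (fun t : ℝ => Real.arctan (100 * t)) (1 / (1 + (100*t)^2) * 100) t := by
      have := ((hasDerivAt_id t).const_mul (100:ℝ)).arctan
      simpa using this
    have h2 := (hasDerivAt_id t).sub (h1.const_mul (1/100))
    refine h2.congr_deriv ?_
    unfold kap
    rw [div_pow, ssq]
    have : (1 + (100*t)^2) ≠ 0 := by positivity
    have := (apos t).ne'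
    field_simp
    ring
  unfold sig2
  rw [mu0_int, intervalIntegral.integral_eq_sub_of_hasDerivAt (fun t _ => hd t)
    ((kap_cont.pow 2).intervalIntegrable _ _)]
  have h1 := Real.arctan_lt_pi_div_two (100*1)
  have h2 := Real.neg_pi_div_two_lt_arctan (100*(-1))
  have h3 := Real.pi_lt_d2
  norm_num at *
  linarith

/-- one-dimensional integration by parts -/
lemma ibp1 (G G' : ℝ → ℝ) (hG : ∀ t, HasDerivAt G (G' t) t) (hc : Continuous G') :
    ∫ t, kap t * G t ∂mu0 = ∫ t, Kk t * G' t ∂mu0 := by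
  rw [mu0_int, mu0_int]
  congr 1
  have := intervalIntegral.integral_mul_deriv_eq_deriv_mul (a := -1) (b := 1)
    (u := G) (v := fun t => - Kk t) (u' := G') (v' := kap)
    (fun t _ => hG t) (fun t _ => by have h := (Kk_deriv t).neg; rw [neg_neg] at h; exact h)
    (hc.intervalIntegrable _ _) (kap_cont.intervalIntegrable _ _)
  simp only [Kk_one, Kk_neg_one] at this
  simp only [neg_zero, mul_zero, sub_zero, zero_sub, mul_neg, intervalIntegral.integral_neg, neg_neg] at this
  simp_rw [mul_comm (kap _), mul_comm (Kk _)]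
  exact this

end Ror


namespace Ror

noncomputable def ppi (N : ℕ) : Measure (Fin N → ℝ) := Measure.pi (fun _ => mu0)

instance (N : ℕ) : IsProbabilityMeasure (ppi N) := by unfold ppi; infer_instance

def boxs (N : ℕ) : Set (Fin N → ℝ) := {v | ∀ i, |v i| ≤ 1}

lemma boxs_eq (N : ℕ) : boxs N = Set.pi Set.univ (fun _ => Set.Icc (-1:ℝ) 1) := by
  ext v; simp only [boxs, abs_le, Set.mem_pi, Set.mem_univ, true_implies, Set.mem_Icc]; rfl

lemma boxs_compact (N : ℕ) : IsCompact (boxs N) := by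
  rw [boxs_eq]; exact isCompact_univ_pi (fun _ => isCompact_Icc)

lemma ppi_ae (N : ℕ) : ∀ᵐ v ∂ppi N, v ∈ boxs N := by
  unfold boxs
  simp only [Set.mem_ofPred_eq]
  rw [ae_all_iff]
  intro i
  exact (measurePreserving_eval (fun _ : Fin N => mu0) i).quasiMeasurePreserving.ae mu0_ae

lemma ppi_restrict (N : ℕ) : (ppi N).restrict (boxs N) = ppi N :=
  Measure.restrict_eq_self_of_ae_mem (ppi_ae N)

lemma ppi_integrable {N : ℕ} {F : (Fin N → ℝ) → ℝ} (hF : Continuous F) :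
    Integrable F (ppi N) := by
  rw [← ppi_restrict]
  exact (hF.continuousOn.integrableOn_compact (boxs_compact N))

lemma ppi_mono {N : ℕ} {F G : (Fin N → ℝ) → ℝ} (hF : Continuous F) (hG : Continuous G)
    (h : ∀ v ∈ boxs N, F v ≤ G v) : ∫ v, F v ∂ppi N ≤ ∫ v, G v ∂ppi N := by
  apply integral_mono_ae (ppi_integrable hF) (ppi_integrable hG)
  filter_upwards [ppi_ae N] with v hv using h v hv

lemma ppi_param {N : ℕ} {X : Type*} [TopologicalSpace X]
    [FirstCountableTopology X] [LocallyCompactSpace X]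
    {F : X → (Fin N → ℝ) → ℝ} (hF : Continuous (Function.uncurry F)) :
    Continuous (fun x => ∫ v, F x v ∂ppi N) := by
  have := continuous_parametric_integral_of_continuous (μ := ppi N) hF (boxs_compact N)
  simpa only [ppi_restrict] using this

lemma ppi_map_update {N : ℕ} (i : Fin N) :
    Measure.map (fun p : (Fin N → ℝ) × ℝ => Function.update p.1 i p.2) ((ppi N).prod mu0) = ppi N := by
  have hm : Measurable (fun p : (Fin N → ℝ) × ℝ => Function.update p.1 i p.2) := by
    apply Continuous.measurable
    exact continuous_fst.update i continuous_snd
  conv_rhs => unfold ppi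
  symm
  apply Measure.pi_eq
  intro s hs
  rw [Measure.map_apply hm (MeasurableSet.univ_pi hs)]
  have : (fun p : (Fin N → ℝ) × ℝ => Function.update p.1 i p.2) ⁻¹' (Set.univ.pi s)
      = (Set.univ.pi (Function.update s i Set.univ)) ×ˢ (s i) := by
    ext ⟨v, t⟩
    simp only [Set.mem_preimage, Set.mem_pi, Set.mem_univ, true_implies, Set.mem_prod]
    constructor
    · intro h
      refine ⟨fun j => ?_, by simpa using h i⟩
      by_cases hj : j = i
      · subst hj; simp
      · have := h j
        simpa [Function.update_of_ne hj] using this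
    · rintro ⟨h1, h2⟩ j
      by_cases hj : j = i
      · subst hj; simpa using h2
      · have := h1 j
        simpa [Function.update_of_ne hj] using this
  rw [this, Measure.prod_prod]
  unfold ppi
  rw [Measure.pi_pi, ← Finset.mul_prod_erase Finset.univ _ (Finset.mem_univ i),
    ← Finset.mul_prod_erase Finset.univ (fun i => mu0 (s i)) (Finset.mem_univ i)]
  simp only [Function.update_self, measure_univ, one_mul]
  rw [mul_comm]
  congr 1
  apply Finset.prod_congr rfl
  intro j hj
  rw [Function.update_of_ne (Finset.ne_of_mem_erase hj)]

lemma ppi_update {N : ℕ} (i : Fin N) {F : (Fin N → ℝ) → ℝ} (hF : Continuous F) :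
    ∫ v, F v ∂ppi N = ∫ v, ∫ t, F (Function.update v i t) ∂mu0 ∂ppi N := by
  have hc : Continuous (fun p : (Fin N → ℝ) × ℝ => Function.update p.1 i p.2) :=
    continuous_fst.update i continuous_snd
  have hI : Integrable F (Measure.map (fun p : (Fin N → ℝ) × ℝ => Function.update p.1 i p.2) ((ppi N).prod mu0)) := by
    rw [ppi_map_update]; exact ppi_integrable hF
  conv_lhs => rw [← ppi_map_update i]
  rw [integral_map hc.measurable.aemeasurable hI.aestronglyMeasurable]
  rw [integral_prod]
  exact (integrable_map_measure hI.aestronglyMeasurable hc.measurable.aemeasurable).1 hI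

/-- integration by parts under the product measure -/
lemma ppi_ibp {N : ℕ} (i : Fin N) {G G' : (Fin N → ℝ) → ℝ} (hG : Continuous G) (hG' : Continuous G')
    (hd : ∀ v t, HasDerivAt (fun t => G (Function.update v i t)) (G' (Function.update v i t)) t) :
    ∫ v, kap (v i) * G v ∂ppi N = ∫ v, Kk (v i) * G' v ∂ppi N := by
  have hk := kap_cont
  have hK := Kk_cont
  rw [ppi_update i (by fun_prop), ppi_update i (F := fun v => Kk (v i) * G' v) (by fun_prop)]
  congr 1
  ext v
  simp only [Function.update_self]
  exact ibp1 _ _ (hd v) (hG'.comp (continuous_const.update i continuous_id))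

/-- functions not depending on coordinate i times a one-coordinate function -/
lemma ppi_split {N : ℕ} (i : Fin N) {f : ℝ → ℝ} {G : (Fin N → ℝ) → ℝ} (hf : Continuous f)
    (hG : Continuous G) (hi : ∀ v t, G (Function.update v i t) = G v) :
    ∫ v, f (v i) * G v ∂ppi N = (∫ t, f t ∂mu0) * ∫ v, G v ∂ppi N := by
  rw [ppi_update i (by fun_prop)]
  simp only [Function.update_self, hi]
  simp_rw [integral_mul_const]
  rw [integral_const_mul]

/-! moments -/

noncomputable def lin {N : ℕ} (u : Fin N → ℝ) (S : Finset (Fin N)) (v : Fin N → ℝ) : ℝ :=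
  ∑ i ∈ S, u i * kap (v i)

lemma lin_cont {N : ℕ} (u : Fin N → ℝ) (S : Finset (Fin N)) : Continuous (lin u S) := by
  have hk := kap_cont
  unfold lin; fun_prop

lemma lin_upd {N : ℕ} (u : Fin N → ℝ) (S : Finset (Fin N)) {i : Fin N} (hi : i ∉ S) (v : Fin N → ℝ) (t : ℝ) :
    lin u S (Function.update v i t) = lin u S v := by
  unfold lin
  apply Finset.sum_congr rfl
  intro j hj
  rw [Function.update_of_ne]
  rintro rfl; exact hi hj

lemma lin_insert {N : ℕ} (u : Fin N → ℝ) (S : Finset (Fin N)) {i : Fin N} (hi : i ∉ S) (v : Fin N → ℝ) :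
    lin u (insert i S) v = u i * kap (v i) + lin u S v := by
  unfold lin; rw [Finset.sum_insert hi]

lemma lin_sq {N : ℕ} (u : Fin N → ℝ) (S : Finset (Fin N)) :
    ∫ v, lin u S v ^ 2 ∂ppi N = sig2 * ∑ i ∈ S, u i ^ 2 := by
  induction S using Finset.induction_on with
  | empty => simp [lin]
  | insert i S hi ih =>
    have hk := kap_cont
    have hl := lin_cont u S
    have e1 : ∀ v, lin u (insert i S) v ^ 2 = u i ^ 2 * ((kap (v i)) ^ 2 * 1)
        + 2 * u i * (kap (v i) * lin u S v) + lin u S v ^ 2 := by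
      intro v; rw [lin_insert u S hi]; ring
    simp_rw [e1]
    rw [integral_add (ppi_integrable (by fun_prop)) (ppi_integrable (by fun_prop)),
      integral_add (ppi_integrable (by fun_prop)) (ppi_integrable (by fun_prop)),
      integral_const_mul, integral_const_mul,
      ppi_split i (f := fun t => kap t ^ 2) (by fun_prop) continuous_const (by simp),
      ppi_split i (f := kap) hk hl (lin_upd u S hi), mu0_kap, ih, Finset.sum_insert hi]
    simp [sig2]; ring

lemma lin_four {N : ℕ} (u : Fin N → ℝ) (S : Finset (Fin N)) :
    ∫ v, lin u S v ^ 4 ∂ppi N ≤ 3 * (∑ i ∈ S, u i ^ 2) ^ 2 := by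
  induction S using Finset.induction_on with
  | empty => simp [lin]
  | insert i S hi ih =>
    have hk := kap_cont
    have hl := lin_cont u S
    have e1 : ∀ v, lin u (insert i S) v ^ 4 = u i ^ 4 * ((kap (v i)) ^ 4 * 1)
        + 4 * u i ^ 3 * (kap (v i) ^ 3 * lin u S v) + 6 * u i ^ 2 * (kap (v i) ^ 2 * lin u S v ^ 2)
        + 4 * u i * (kap (v i) * lin u S v ^ 3) + lin u S v ^ 4 := by
      intro v; rw [lin_insert u S hi]; ring
    simp_rw [e1]
    rw [integral_add (ppi_integrable (by fun_prop)) (ppi_integrable (by fun_prop)),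
      integral_add (ppi_integrable (by fun_prop)) (ppi_integrable (by fun_prop)),
      integral_add (ppi_integrable (by fun_prop)) (ppi_integrable (by fun_prop)),
      integral_add (ppi_integrable (by fun_prop)) (ppi_integrable (by fun_prop)),
      integral_const_mul, integral_const_mul, integral_const_mul, integral_const_mul,
      ppi_split i (f := fun t => kap t ^ 4) (by fun_prop) continuous_const (by simp),
      ppi_split i (f := fun t => kap t ^ 3) (by fun_prop) hl (lin_upd u S hi),
      ppi_split i (f := fun t => kap t ^ 2) (G := fun v => lin u S v ^ 2) (by fun_prop) (hl.pow 2) (by intro v t; simp only [lin_upd u S hi]),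
      ppi_split i (f := kap) (G := fun v => lin u S v ^ 3) hk (hl.pow 3) (by intro v t; simp only [lin_upd u S hi]),
      mu0_kap, mu0_kap3, Finset.sum_insert hi]
    have h2 := lin_sq u S
    rw [h2]
    have h4 := mu0_kap4
    rw [← sig2]
    simp only [integral_const, probReal_univ, smul_eq_mul, mul_one, zero_mul, mul_zero, add_zero]
    have s1 := sig2_le
    have s0 := sig2_nonneg
    set A := ∑ i ∈ S, u i ^ 2
    have hA : 0 ≤ A := Finset.sum_nonneg (fun _ _ => sq_nonneg _)
    have h5 : u i ^ 4 * (∫ t, kap t ^ 4 ∂mu0) ≤ u i ^ 4 * 1 :=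
      mul_le_mul_of_nonneg_left h4 (by positivity)
    have h6 : sig2 * (sig2 * A) ≤ A := by nlinarith [mul_nonneg s0 hA]
    have h7 : 6 * u i ^ 2 * (sig2 * (sig2 * A)) ≤ 6 * u i ^ 2 * A :=
      mul_le_mul_of_nonneg_left h6 (by positivity)
    nlinarith [sq_nonneg (u i ^ 2)]

lemma abs_poly (y : ℝ) : 0.9 * y ^ 2 - 0.108 * y ^ 4 ≤ |y| := by
  rw [← sq_abs, show y ^ 4 = |y| ^ 4 by rw [show (4:ℕ) = 2 * 2 by rfl, pow_mul, pow_mul, sq_abs]]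
  have h := abs_nonneg y
  generalize |y| = a at *
  have : 0 ≤ 1 - 0.9 * a + 0.108 * a ^ 3 := by nlinarith [sq_nonneg (a - 5/3), mul_nonneg h (sq_nonneg (a - 5/3))]
  nlinarith [mul_nonneg h this]

lemma lin_kap {N : ℕ} (u : Fin N → ℝ) (hu : ∑ i, u i ^ 2 = 1) :
    0.548 ≤ ∫ v, lin u Finset.univ v * kap (lin u Finset.univ v) ∂ppi N := by
  have hk := kap_cont
  have hl := lin_cont u Finset.univ
  have h1 : ∫ v, (0.9 * lin u Finset.univ v ^ 2 - 0.108 * lin u Finset.univ v ^ 4 - 1/100) ∂ppi N ≤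
      ∫ v, lin u Finset.univ v * kap (lin u Finset.univ v) ∂ppi N := by
    apply ppi_mono (by fun_prop) (by fun_prop)
    intro v _
    have := abs_poly (lin u Finset.univ v)
    have := tkap (lin u Finset.univ v)
    linarith
  rw [integral_sub (ppi_integrable (by fun_prop)) (ppi_integrable (by fun_prop)),
    integral_sub (ppi_integrable (by fun_prop)) (ppi_integrable (by fun_prop)),
    integral_const_mul, integral_const_mul, lin_sq, hu] at h1
  have h4 := lin_four u Finset.univ
  rw [hu] at h4
  have := sig2_ge
  simp only [integral_const, probReal_univ, smul_eq_mul] at h1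
  linarith

end Ror


namespace Ror

def sg (b : Bool) : ℝ := if b then 1 else -1

noncomputable def sgo : Option Bool → ℝ
  | none => 0
  | some b => sg b / 2

noncomputable def pf : Option Bool → ℝ → ℝ
  | none, _ => 1
  | some b, z => (1 + sg b * z) / 2

noncomputable def rho : ℝ := 24/25

lemma sg_sq (b : Bool) : sg b * sg b = 1 := by cases b <;> simp [sg]
lemma sg_abs (b : Bool) : |sg b| = 1 := by cases b <;> simp [sg]

lemma pf_cont (o : Option Bool) : Continuous (pf o) := by
  cases o with
  | none => exact continuous_const
  | some b => unfold pf; fun_prop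

lemma pf_deriv (o : Option Bool) (z : ℝ) : HasDerivAt (pf o) (sgo o) z := by
  cases o with
  | none => exact hasDerivAt_const z (1:ℝ)
  | some b =>
    unfold pf sgo
    have := (((hasDerivAt_id z).const_mul (sg b)).const_add 1).div_const 2
    simpa using this

lemma pf_ge {o : Option Bool} {z : ℝ} (hz : |z| ≤ rho) : 1/50 ≤ pf o z := by
  cases o with
  | none => simp [pf]; norm_num
  | some b =>
    have h := abs_le.1 hz
    unfold rho at h
    cases b <;> simp [pf, sg] <;> linarith [h.1, h.2]

lemma pf_pos {o : Option Bool} {z : ℝ} (hz : |z| ≤ rho) : 0 < pf o z :=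
  lt_of_lt_of_le (by norm_num) (pf_ge hz)

lemma sgo_abs (o : Option Bool) : |sgo o| ≤ 1/2 := by
  cases o with
  | none => simp [sgo]
  | some b => cases b <;> simp [sgo, sg, abs_div]

noncomputable def wt (o : Option Bool) (z : ℝ) : ℝ := sgo o / pf o z

lemma wt_abs {o : Option Bool} {z : ℝ} (hz : |z| ≤ rho) : |wt o z| ≤ 25 := by
  unfold wt
  have h := pf_ge (o := o) hz
  have h1 := sgo_abs o
  rw [abs_div, abs_of_pos (pf_pos hz), div_le_iff₀ (pf_pos hz)]
  linarith

lemma wt_none (z : ℝ) : wt none z = 0 := by simp [wt, sgo]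

section blocks
variable {N : ℕ}

noncomputable def PP (o : Fin N → Option Bool) (Z : Fin N → ℝ) : ℝ := ∏ i, pf (o i) (Z i)
noncomputable def PD (o : Fin N → Option Bool) (i : Fin N) (Z : Fin N → ℝ) : ℝ :=
  sgo (o i) * ∏ j ∈ Finset.univ.erase i, pf (o j) (Z j)

lemma PP_cont (o : Fin N → Option Bool) : Continuous (PP o) := by
  have := pf_cont
  unfold PP; fun_prop
lemma PD_cont (o : Fin N → Option Bool) (i : Fin N) : Continuous (PD o i) := by
  have := pf_cont
  unfold PD; fun_prop

lemma PP_deriv (o : Fin N → Option Bool) (Z : Fin N → ℝ) :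
    HasFDerivAt (PP o) (∑ i, PD o i Z • ContinuousLinearMap.proj (R := ℝ) (φ := fun _ : Fin N => ℝ) i) Z := by
  have h : ∀ i ∈ (Finset.univ : Finset (Fin N)), HasFDerivAt (fun Z : Fin N → ℝ => pf (o i) (Z i))
      (sgo (o i) • ContinuousLinearMap.proj (R := ℝ) (φ := fun _ : Fin N => ℝ) i) Z := by
    intro i _
    have h1 : HasFDerivAt (fun Z : Fin N → ℝ => Z i) (ContinuousLinearMap.proj (R := ℝ) (φ := fun _ : Fin N => ℝ) i) Z :=
      (ContinuousLinearMap.proj (R := ℝ) (φ := fun _ : Fin N => ℝ) i).hasFDerivAt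
    exact (pf_deriv (o i) (Z i)).comp_hasFDerivAt Z h1
  have := HasFDerivAt.finsetProd h
  refine this.congr_fderiv ?_
  apply Finset.sum_congr rfl
  intro i _
  rw [smul_smul]; unfold PD; congr 1; ring

lemma PP_pos {o : Fin N → Option Bool} {Z : Fin N → ℝ} (hZ : ∀ i, |Z i| ≤ rho) : 0 < PP o Z :=
  Finset.prod_pos (fun i _ => pf_pos (hZ i))

lemma PD_eq {o : Fin N → Option Bool} {i : Fin N} {Z : Fin N → ℝ} (hZ : |Z i| ≤ rho) :
    PD o i Z = wt (o i) (Z i) * PP o Z := by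
  unfold PD PP wt
  rw [← Finset.mul_prod_erase Finset.univ (fun j => pf (o j) (Z j)) (Finset.mem_univ i)]
  have := (pf_pos (o := o i) hZ).ne'
  field_simp

lemma PD_upd {o : Fin N → Option Bool} {i : Fin N} {Z Z' : Fin N → ℝ} (h : ∀ j, j ≠ i → Z j = Z' j) :
    PD o i Z = PD o i Z' := by
  unfold PD
  congr 1
  apply Finset.prod_congr rfl
  intro j hj
  rw [h j (Finset.ne_of_mem_erase hj)]

def suppc (o : Fin N → Option Bool) : Finset (Fin N) := Finset.univ.filter (fun i => o i ≠ none)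

lemma mem_suppc {o : Fin N → Option Bool} {i : Fin N} : i ∈ suppc o ↔ o i ≠ none := by simp [suppc]

variable (U : Fin N → Fin N → ℝ)

noncomputable def YY (v : Fin N → ℝ) (j : Fin N) : ℝ := lin (fun i => U i j) Finset.univ v
noncomputable def HH (v : Fin N → ℝ) (j : Fin N) : ℝ := kap (YY U v j)

lemma YY_cont (j : Fin N) : Continuous (fun v => YY U v j) := lin_cont _ _
lemma HH_cont : Continuous (HH U) := by
  apply continuous_pi
  intro j
  exact kap_cont.comp (YY_cont U j)

lemma HH_box (v : Fin N → ℝ) : HH U v ∈ boxs N := fun j => kap_abs _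

noncomputable def LL : (n : ℕ) → (Fin (n+1) → Fin N → Option Bool) → (Fin N → ℝ) → ℝ
  | 0, a, Y => PP (a 0) (fun i => rho * Y i)
  | n+1, a, Y => ∫ v, PP (a 0) (fun i => rho * (Y i * kap (v i))) * LL n (Fin.tail a) (HH U v) ∂ppi N

noncomputable def DL : (n : ℕ) → (Fin (n+1) → Fin N → Option Bool) → Fin N → (Fin N → ℝ) → ℝ
  | 0, a, i, Y => rho * PD (a 0) i (fun i => rho * Y i)
  | n+1, a, i, Y => ∫ v, (rho * kap (v i) * PD (a 0) i (fun i => rho * (Y i * kap (v i)))) * LL U n (Fin.tail a) (HH U v) ∂ppi N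

lemma ppi_fderiv {F : (Fin N → ℝ) → (Fin N → ℝ) → ℝ} {D : Fin N → (Fin N → ℝ) → (Fin N → ℝ) → ℝ}
    (hF : Continuous (Function.uncurry F)) (hD : ∀ i, Continuous (Function.uncurry (D i)))
    (hd : ∀ v Y, HasFDerivAt (fun Y => F Y v) (∑ i, D i Y v • ContinuousLinearMap.proj (R := ℝ) (φ := fun _ : Fin N => ℝ) i) Y)
    (Y : Fin N → ℝ) :
    HasFDerivAt (fun Y => ∫ v, F Y v ∂ppi N)
      (∑ i, (∫ v, D i Y v ∂ppi N) • ContinuousLinearMap.proj (R := ℝ) (φ := fun _ : Fin N => ℝ) i) Y := by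
  set F' : (Fin N → ℝ) → (Fin N → ℝ) → ((Fin N → ℝ) →L[ℝ] ℝ) :=
    fun Y v => ∑ i, D i Y v • ContinuousLinearMap.proj (R := ℝ) (φ := fun _ : Fin N => ℝ) i with hF'
  have hF'c : Continuous (Function.uncurry F') := by
    have : Function.uncurry F' = fun p : (Fin N → ℝ) × (Fin N → ℝ) => ∑ i, Function.uncurry (D i) p • ContinuousLinearMap.proj (R := ℝ) (φ := fun _ : Fin N => ℝ) i := by
      ext1 ⟨a, b⟩; rfl
    rw [this]
    fun_prop
  obtain ⟨C, hC⟩ := ((isCompact_closedBall Y 1).prod (boxs_compact N)).exists_bound_of_continuousOn hF'c.continuousOn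
  have key := hasFDerivAt_integral_of_dominated_of_fderiv_le (𝕜 := ℝ) (μ := ppi N) (F := F) (F' := F') (x₀ := Y)
    (s := Metric.closedBall Y 1) (bound := fun _ => C)
    (Metric.closedBall_mem_nhds Y one_pos)
    (Filter.Eventually.of_forall (fun x => (hF.comp (by fun_prop : Continuous (fun v => (x, v)))).aestronglyMeasurable))
    (ppi_integrable (hF.comp (by fun_prop : Continuous (fun v => (Y, v)))))
    ((hF'c.comp (by fun_prop : Continuous (fun v => (Y, v)))).aestronglyMeasurable)
    (by filter_upwards [ppi_ae N] with v hv x hx using hC (x, v) ⟨hx, hv⟩)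
    (integrable_const _)
    (Filter.Eventually.of_forall (fun v x _ => hd v x))
  have hI : ∀ i, Integrable (fun v => D i Y v) (ppi N) := fun i =>
    ppi_integrable ((hD i).comp (by fun_prop : Continuous (fun v => (Y, v))))
  refine key.congr_fderiv ?_
  symm
  rw [hF', integral_finsetSum _ (fun i _ => (hI i).smul_const _)]
  apply Finset.sum_congr rfl
  intro i _
  rw [integral_smul_const]

lemma LL_good (n : ℕ) (a : Fin (n+1) → Fin N → Option Bool) :
    Continuous (LL U n a) ∧ (∀ i, Continuous (DL U n a i)) ∧
    ∀ Y, HasFDerivAt (LL U n a) (∑ i, DL U n a i Y • ContinuousLinearMap.proj (R := ℝ) (φ := fun _ : Fin N => ℝ) i) Y := by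
  have hk := kap_cont
  have chain : ∀ (o : Fin N → Option Bool) (c : Fin N → ℝ) (Y : Fin N → ℝ),
      HasFDerivAt (fun Y : Fin N → ℝ => PP o (fun i => rho * (Y i * c i)))
      (∑ i, (rho * c i * PD o i (fun i => rho * (Y i * c i))) • ContinuousLinearMap.proj (R := ℝ) (φ := fun _ : Fin N => ℝ) i) Y := by
    intro o c Y
    have h1 : HasFDerivAt (fun Y : Fin N → ℝ => (fun i => rho * (Y i * c i)))
        (ContinuousLinearMap.pi fun i => (rho * c i) • ContinuousLinearMap.proj (R := ℝ) (φ := fun _ : Fin N => ℝ) i) Y := by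
      rw [hasFDerivAt_pi]
      intro i
      have : (fun Y : Fin N → ℝ => rho * (Y i * c i)) = fun Y => ((rho * c i) • ContinuousLinearMap.proj (R := ℝ) (φ := fun _ : Fin N => ℝ) i) Y := by
        ext Y; simp; ring
      rw [this]
      exact ContinuousLinearMap.hasFDerivAt _
    have h2 := (PP_deriv o (fun i => rho * (Y i * c i))).comp Y h1
    refine h2.congr_fderiv ?_
    ext x
    simp
    apply Finset.sum_congr rfl
    intros; ring
  induction n with
  | zero =>
    refine ⟨?_, ?_, ?_⟩
    · show Continuous (fun Y : Fin N → ℝ => PP (a 0) (fun i => rho * Y i)); exact (PP_cont _).comp (by fun_prop)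
    · intro i; show Continuous (fun Y : Fin N → ℝ => rho * PD (a 0) i (fun i => rho * Y i)); exact continuous_const.mul ((PD_cont _ _).comp (by fun_prop))
    · intro Y
      have := chain (a 0) (fun _ => 1) Y
      simpa [LL, DL] using this
  | succ n ih =>
    obtain ⟨h1, h2, h3⟩ := ih (Fin.tail a)
    have hH := HH_cont U
    have cF : Continuous (Function.uncurry (fun Y v : Fin N → ℝ => PP (a 0) (fun i => rho * (Y i * kap (v i))) * LL U n (Fin.tail a) (HH U v))) := by
      unfold Function.uncurry
      apply Continuous.mul
      · exact (PP_cont _).comp (by fun_prop)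
      · exact h1.comp (hH.comp (by fun_prop))
    have cD : ∀ i, Continuous (Function.uncurry (fun Y v : Fin N → ℝ => (rho * kap (v i) * PD (a 0) i (fun i => rho * (Y i * kap (v i)))) * LL U n (Fin.tail a) (HH U v))) := by
      intro i
      unfold Function.uncurry
      apply Continuous.mul
      · apply Continuous.mul (by fun_prop)
        exact (PD_cont _ _).comp (by fun_prop)
      · exact h1.comp (hH.comp (by fun_prop))
    refine ⟨?_, ?_, ?_⟩
    · exact ppi_param cF
    · intro i; exact ppi_param (cD i)
    · intro Y
      have := ppi_fderiv cF cD ?_ Y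
      · exact this
      · intro v Y
        have := (chain (a 0) (fun i => kap (v i)) Y).mul_const (LL U n (Fin.tail a) (HH U v))
        refine this.congr_fderiv ?_
        rw [Finset.smul_sum]
        apply Finset.sum_congr rfl
        intro i _
        rw [smul_smul, mul_comm]

lemma rY {Y : Fin N → ℝ} (hY : Y ∈ boxs N) (i : Fin N) : |rho * Y i| ≤ rho := by
  rw [abs_mul, abs_of_pos (by unfold rho; norm_num : (0:ℝ) < rho)]
  have := hY i
  unfold rho; linarith

lemma rYk {Y : Fin N → ℝ} (hY : Y ∈ boxs N) (i : Fin N) (t : ℝ) : |rho * (Y i * kap t)| ≤ rho := by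
  rw [abs_mul, abs_mul, abs_of_pos (by unfold rho; norm_num : (0:ℝ) < rho)]
  have := hY i
  have h2 := kap_abs t
  have : |Y i| * |kap t| ≤ 1 := by nlinarith [abs_nonneg (Y i), abs_nonneg (kap t)]
  unfold rho; linarith

lemma LL_nonneg (n : ℕ) (a : Fin (n+1) → Fin N → Option Bool) {Y : Fin N → ℝ} (hY : Y ∈ boxs N) :
    0 ≤ LL U n a Y := by
  induction n generalizing Y with
  | zero => exact (PP_pos (rY hY)).le
  | succ n ih =>
    apply integral_nonneg
    intro v
    exact mul_nonneg (PP_pos (fun i => rYk hY i _)).le (ih _ (HH_box U v))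

lemma DL_zero (n : ℕ) (a : Fin (n+1) → Fin N → Option Bool) {i : Fin N} (hi : a 0 i = none) (Y : Fin N → ℝ) :
    DL U n a i Y = 0 := by
  cases n <;> simp [DL, PD, hi, sgo]

/-- derivative of LL∘HH along a coordinate -/
lemma LLH_deriv (n : ℕ) (a : Fin (n+1) → Fin N → Option Bool) (i : Fin N) (v : Fin N → ℝ) (t : ℝ) :
    HasDerivAt (fun t => LL U n a (HH U (Function.update v i t)))
      (kapd t * ∑ l, U i l * (kapd (YY U (Function.update v i t) l) * DL U n a l (HH U (Function.update v i t)))) t := by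
  have hy : ∀ l, HasDerivAt (fun t => YY U (Function.update v i t) l) (U i l * kapd t) t := by
    intro l
    unfold YY lin
    have e : (fun t : ℝ => ∑ j, U j l * kap (Function.update v i t j)) =
        fun t => U i l * kap t + ∑ j ∈ Finset.univ.erase i, U j l * kap (v j) := by
      ext t
      rw [← Finset.add_sum_erase _ _ (Finset.mem_univ i)]
      congr 1
      · simp
      · apply Finset.sum_congr rfl
        intro j hj
        rw [Function.update_of_ne (Finset.ne_of_mem_erase hj)]
    rw [e]
    exact ((kap_deriv t).const_mul _).add_const _
  have hH : HasDerivAt (fun t => HH U (Function.update v i t))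
      (fun l => kapd (YY U (Function.update v i t) l) * (U i l * kapd t)) t := by
    rw [hasDerivAt_pi]
    intro l
    exact (kap_deriv _).comp t (hy l)
  have := ((LL_good U n a).2.2 (HH U (Function.update v i t))).comp_hasDerivAt t hH
  refine this.congr_deriv ?_
  simp only [sum_apply, smul_apply, ContinuousLinearMap.proj_apply, smul_eq_mul]
  rw [Finset.mul_sum]
  apply Finset.sum_congr rfl
  intros; ring

/-- integration by parts formula for DL -/
lemma DL_ibp (n : ℕ) (a : Fin (n+2) → Fin N → Option Bool) (i : Fin N) (Y : Fin N → ℝ) :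
    DL U (n+1) a i Y = ∫ v, (rho * Kk (v i) * kapd (v i)) * PD (a 0) i (fun i => rho * (Y i * kap (v i))) *
      ∑ l, U i l * (kapd (YY U v l) * DL U n (Fin.tail a) l (HH U v)) ∂ppi N := by
  have hk := kap_cont
  have hkd := kapd_cont
  have hK := Kk_cont
  have hH := HH_cont U
  have hY := YY_cont U
  obtain ⟨g1, g2, g3⟩ := LL_good U n (Fin.tail a)
  have hP : Continuous (fun v : Fin N → ℝ => PD (a 0) i (fun i => rho * (Y i * kap (v i)))) :=
    (PD_cont _ _).comp (by fun_prop)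
  have := ppi_ibp i (G := fun v => rho * PD (a 0) i (fun i => rho * (Y i * kap (v i))) * LL U n (Fin.tail a) (HH U v))
    (G' := fun v => rho * PD (a 0) i (fun i => rho * (Y i * kap (v i))) *
      (kapd (v i) * ∑ l, U i l * (kapd (YY U v l) * DL U n (Fin.tail a) l (HH U v))))
    (by fun_prop) (by fun_prop) ?_
  · rw [DL]
    convert this using 1
    · congr 1; ext v; ring
    · congr 1; ext v; ring
  · intro v t
    have e : ∀ t, PD (a 0) i (fun j => rho * (Y j * kap (Function.update v i t j))) = PD (a 0) i (fun j => rho * (Y j * kap (v j))) := by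
      intro t
      apply PD_upd
      intro j hj
      rw [Function.update_of_ne hj]
    simp only [e, Function.update_self]
    exact (LLH_deriv U n (Fin.tail a) i v t).const_mul _

end blocks
end Ror


namespace Ror

lemma opNorm_le {m n : Type} [Fintype m] [Fintype n] (A : m → n → ℝ) (x : n → ℝ) :
    √(∑ i, (∑ j, A i j * x j) ^ 2) ≤ opNorm A * √(∑ j, x j ^ 2) := by
  by_cases hx : x = 0
  · subst hx; simp
  have hpos : 0 < ∑ j, x j ^ 2 := by
    obtain ⟨j, hj⟩ := Function.ne_iff.1 hx
    apply Finset.sum_pos' (fun _ _ => sq_nonneg _) ⟨j, Finset.mem_univ _, ?_⟩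
    have : x j ≠ 0 := hj
    positivity
  rw [← div_le_iff₀ (Real.sqrt_pos.2 hpos)]
  unfold opNorm
  apply le_csSup
  · refine ⟨√(∑ i, ∑ j, A i j ^ 2), ?_⟩
    rintro r ⟨y, hy, rfl⟩
    apply div_le_of_le_mul₀ (Real.sqrt_nonneg _) (Real.sqrt_nonneg _)
    rw [← Real.sqrt_mul (Finset.sum_nonneg (fun _ _ => Finset.sum_nonneg (fun _ _ => sq_nonneg _)))]
    apply Real.sqrt_le_sqrt
    rw [Finset.sum_mul]
    apply Finset.sum_le_sum
    intro i _
    exact Finset.sum_mul_sq_le_sq_mul_sq _ _ _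
  · exact ⟨x, hx, rfl⟩

lemma cs_abs {ι : Type*} (s : Finset ι) (f g : ι → ℝ) :
    |∑ i ∈ s, f i * g i| ≤ √(∑ i ∈ s, f i ^ 2) * √(∑ i ∈ s, g i ^ 2) := by
  rw [← Real.sqrt_mul (Finset.sum_nonneg (fun _ _ => sq_nonneg _))]
  apply Real.abs_le_sqrt
  exact Finset.sum_mul_sq_le_sq_mul_sq _ _ _

def BilB {N : ℕ} (U : Fin N → Fin N → ℝ) (D : ℕ) (δ : ℝ) : Prop :=
  ∀ (S T : Finset (Fin N)) (α β : Fin N → ℝ), S.card + T.card ≤ D → (∀ i, i ∉ S → α i = 0) →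
    (∀ i, i ∉ T → β i = 0) →
    |∑ i, α i * ∑ l, U i l * β l| ≤ δ * (√(∑ i, α i ^ 2) * √(∑ l, β l ^ 2))

lemma good_bil {N : ℕ} {U : Fin N → Fin N → ℝ} (hU : IsGood U) (D : ℕ) :
    BilB U D √(100 * D * Real.log N / N) := by
  intro S T α β hD hα hβ
  have hlog : 0 ≤ Real.log N := Real.log_natCast_nonneg N
  rcases S.eq_empty_or_nonempty with rfl | hS
  · have : ∀ i, α i = 0 := fun i => hα i (by simp)
    simp [this]
  rcases T.eq_empty_or_nonempty with rfl | hT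
  · have : ∀ i, β i = 0 := fun i => hβ i (by simp)
    simp [this]
  have h1 := hU S T hS hT
  have h2 : √(100 * (S.card + T.card) * Real.log N / N) ≤ √(100 * D * Real.log N / N) := by
    apply Real.sqrt_le_sqrt
    have : ((S.card : ℝ) + T.card) ≤ D := by exact_mod_cast hD
    gcongr
  have h3 := opNorm_le (fun (i : {a // a ∈ S}) (j : {a // a ∈ T}) => U i.val j.val) (fun j => β j.val)
  have e1 : ∑ i, α i * ∑ l, U i l * β l = ∑ i ∈ S, α i * ∑ l ∈ T, U i l * β l := by
    rw [← Finset.sum_subset (Finset.subset_univ S)]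
    · apply Finset.sum_congr rfl
      intro i _
      congr 1
      symm
      apply Finset.sum_subset (Finset.subset_univ T)
      intro l _ hl
      rw [hβ l hl, mul_zero]
    · intro i _ hi
      rw [hα i hi, zero_mul]
  have e2 : ∑ j : {a // a ∈ T}, β j.val ^ 2 = ∑ l, β l ^ 2 := by
    rw [Finset.sum_coe_sort T (fun l => β l ^ 2)]
    apply Finset.sum_subset (Finset.subset_univ T)
    intro l _ hl
    rw [hβ l hl]; ring
  have e3 : ∑ i : {a // a ∈ S}, (∑ j : {a // a ∈ T}, U i.val j.val * β j.val) ^ 2 =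
      ∑ i ∈ S, (∑ l ∈ T, U i l * β l) ^ 2 := by
    rw [← Finset.sum_coe_sort S]
    apply Finset.sum_congr rfl
    intro i _
    rw [← Finset.sum_coe_sort T]
  have e4 : ∑ i ∈ S, α i ^ 2 = ∑ i, α i ^ 2 := by
    apply Finset.sum_subset (Finset.subset_univ S)
    intro l _ hl
    rw [hα l hl]; ring
  rw [e2, e3] at h3
  rw [e1]
  refine (cs_abs S _ _).trans ?_
  rw [e4]
  have h4 : √(∑ i ∈ S, (∑ l ∈ T, U i l * β l) ^ 2) ≤ √(100 * D * Real.log N / N) * √(∑ l, β l ^ 2) := by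
    refine h3.trans ?_
    apply mul_le_mul_of_nonneg_right _ (Real.sqrt_nonneg _)
    exact h1.trans h2
  calc _ ≤ √(∑ i, α i ^ 2) * (√(100 * D * Real.log N / N) * √(∑ l, β l ^ 2)) :=
        mul_le_mul_of_nonneg_left h4 (Real.sqrt_nonneg _)
    _ = _ := by ring

section grad
variable {N : ℕ} (U : Fin N → Fin N → ℝ)

def tsup {n : ℕ} (a : Fin n → Fin N → Option Bool) : ℕ := ∑ b, (suppc (a b)).card

lemma PD_sq {o : Fin N → Option Bool} {Z : Fin N → ℝ} (hZ : ∀ i, |Z i| ≤ rho) :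
    ∑ i, PD o i Z ^ 2 ≤ 625 * (suppc o).card * PP o Z ^ 2 := by
  rw [← Finset.sum_subset (Finset.subset_univ (suppc o))]
  · have : ∀ i ∈ suppc o, PD o i Z ^ 2 ≤ 625 * PP o Z ^ 2 := by
      intro i _
      rw [PD_eq (hZ i), mul_pow]
      have := wt_abs (o := o i) (hZ i)
      have h2 : wt (o i) (Z i) ^ 2 ≤ 625 := by
        rw [← sq_abs]; nlinarith [abs_nonneg (wt (o i) (Z i))]
      exact mul_le_mul_of_nonneg_right h2 (sq_nonneg _)
    refine (Finset.sum_le_card_nsmul _ _ _ this).trans ?_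
    rw [nsmul_eq_mul]; apply le_of_eq; ring
  · intro i _ hi
    have : o i = none := by simpa [mem_suppc] using hi
    simp [PD, this, sgo]

lemma grad_bound {D : ℕ} {δ : ℝ} (hδ : 0 ≤ δ) (hB : BilB U D δ) (n : ℕ) (a : Fin (n+1) → Fin N → Option Bool)
    (ha : tsup a ≤ D) {Y : Fin N → ℝ} (hY : Y ∈ boxs N) :
    √(∑ i, DL U n a i Y ^ 2) ≤ 25 * √D * (250000 * δ) ^ n * LL U n a Y := by
  induction n generalizing Y with
  | zero =>
    have h1 := PD_sq (o := a 0) (rY hY)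
    have hP := PP_pos (o := a 0) (rY hY)
    have hs : ((suppc (a 0)).card : ℝ) ≤ D := by
      have : (suppc (a 0)).card ≤ D := by simpa [tsup] using ha
      exact_mod_cast this
    simp only [DL, LL, pow_zero, mul_one]
    apply Real.sqrt_le_iff.2
    refine ⟨by positivity, ?_⟩
    rw [mul_pow, mul_pow, Real.sq_sqrt (by positivity)]
    simp_rw [mul_pow]
    rw [← Finset.mul_sum]
    have hr : rho ^ 2 ≤ 1 := by unfold rho; norm_num
    have h0 : 0 ≤ ∑ i, PD (a 0) i (fun i => rho * Y i) ^ 2 := Finset.sum_nonneg (fun _ _ => sq_nonneg _)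
    have h2 : 625 * ((suppc (a 0)).card:ℝ) * PP (a 0) (fun i => rho * Y i) ^ 2 ≤ 625 * D * PP (a 0) (fun i => rho * Y i) ^ 2 := by
      gcongr
    nlinarith
  | succ n ih =>
    have ht : tsup a = (suppc (a 0)).card + tsup (Fin.tail a) := by
      unfold tsup; rw [Fin.sum_univ_succ]; rfl
    have htail : tsup (Fin.tail a) ≤ D := by omega
    have hadj : (suppc (a 0)).card + (suppc (a 1)).card ≤ D := by
      have : (suppc (a 1)).card ≤ tsup (Fin.tail a) := by
        unfold tsup
        exact Finset.single_le_sum (f := fun b => (suppc (Fin.tail a b)).card) (fun _ _ => Nat.zero_le _) (Finset.mem_univ 0)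
      omega
    have IH := fun v => ih (Fin.tail a) htail (HH_box U v)
    set c : Fin N → ℝ := fun i => DL U (n+1) a i Y with hc
    set S : ℝ := ∑ i, c i ^ 2 with hS
    have hS0 : 0 ≤ S := Finset.sum_nonneg (fun _ _ => sq_nonneg _)
    set K : ℝ := 25 * √D * (250000 * δ) ^ (n+1) with hK
    have hK0 : 0 ≤ K := by positivity
    have hk := kap_cont
    have hkd := kapd_cont
    have hKc := Kk_cont
    have hH := HH_cont U
    have hYc := YY_cont U
    obtain ⟨g1, g2, g3⟩ := LL_good U n (Fin.tail a)
    have hP : ∀ i, Continuous (fun v : Fin N → ℝ => PD (a 0) i (fun i => rho * (Y i * kap (v i)))) :=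
      fun i => (PD_cont _ _).comp (by fun_prop)
    have hPP : Continuous (fun v : Fin N → ℝ => PP (a 0) (fun i => rho * (Y i * kap (v i)))) :=
      (PP_cont _).comp (by fun_prop)
    have main : S ≤ √S * K * LL U (n+1) a Y := by
      have e1 : S = ∫ v, ∑ i, c i * ((rho * Kk (v i) * kapd (v i)) * PD (a 0) i (fun i => rho * (Y i * kap (v i))) *
          ∑ l, U i l * (kapd (YY U v l) * DL U n (Fin.tail a) l (HH U v))) ∂ppi N := by
        rw [integral_finsetSum _ (fun i _ => ppi_integrable (by have := hP i; fun_prop))]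
        rw [hS]
        apply Finset.sum_congr rfl
        intro i _
        rw [integral_const_mul, ← DL_ibp]
        ring
      have e2 : √S * K * LL U (n+1) a Y = ∫ v, √S * K * (PP (a 0) (fun i => rho * (Y i * kap (v i))) * LL U n (Fin.tail a) (HH U v)) ∂ppi N := by
        rw [integral_const_mul]; rfl
      rw [e2]
      conv_lhs => rw [e1]
      apply ppi_mono
      · fun_prop
      · fun_prop
      intro v hv
      set Z : Fin N → ℝ := fun i => rho * (Y i * kap (v i)) with hZ
      have hZr : ∀ i, |Z i| ≤ rho := fun i => rYk hY i _
      have hPPp := PP_pos (o := a 0) hZr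
      set α : Fin N → ℝ := fun i => c i * (rho * Kk (v i) * kapd (v i)) * wt (a 0 i) (Z i) with hα
      set β : Fin N → ℝ := fun l => kapd (YY U v l) * DL U n (Fin.tail a) l (HH U v) with hβ
      have e3 : ∑ i, c i * ((rho * Kk (v i) * kapd (v i)) * PD (a 0) i Z * ∑ l, U i l * β l) =
          PP (a 0) Z * ∑ i, α i * ∑ l, U i l * β l := by
        rw [Finset.mul_sum]
        apply Finset.sum_congr rfl
        intro i _
        rw [PD_eq (hZr i), hα]; ring
      rw [e3]
      have hb := hB (suppc (a 0)) (suppc (a 1)) α β hadj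
        (by intro i hi
            have : a 0 i = none := by simpa [mem_suppc] using hi
            simp [hα, this, wt_none])
        (by intro i hi
            have : a 1 i = none := by simpa [mem_suppc] using hi
            have h0 : Fin.tail a 0 i = none := this
            simp only [hβ]
            rw [DL_zero U n (Fin.tail a) h0, mul_zero])
      have hαn : √(∑ i, α i ^ 2) ≤ 2500 * √S := by
        apply Real.sqrt_le_iff.2
        refine ⟨by positivity, ?_⟩
        rw [mul_pow, Real.sq_sqrt hS0, hS, Finset.mul_sum]
        apply Finset.sum_le_sum
        intro i _
        have b1 : |(rho * Kk (v i) * kapd (v i)) * wt (a 0 i) (Z i)| ≤ 2500 := by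
          have x1 : |rho * Kk (v i)| ≤ 1 := by
            rw [abs_mul, abs_of_nonneg (Kk_nonneg (hv i)), abs_of_nonneg (by unfold rho; norm_num)]
            have := Kk_le (v i); have := Kk_nonneg (hv i)
            unfold rho; linarith
          have x2 : |kapd (v i)| ≤ 100 := by
            rw [abs_of_nonneg (kapd_nonneg _)]; exact kapd_le _
          have x3 := wt_abs (o := a 0 i) (hZr i)
          rw [abs_mul, abs_mul]
          calc _ ≤ (1:ℝ) * 100 * 25 := by gcongr
            _ = 2500 := by norm_num
        have b2 : ((rho * Kk (v i) * kapd (v i)) * wt (a 0 i) (Z i)) ^ 2 ≤ 2500 ^ 2 := by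
          rw [← sq_abs]; gcongr
        have : α i ^ 2 = ((rho * Kk (v i) * kapd (v i)) * wt (a 0 i) (Z i)) ^ 2 * c i ^ 2 := by
          simp only [hα]; ring
        rw [this]
        exact mul_le_mul_of_nonneg_right b2 (sq_nonneg _)
      have hβn : √(∑ i, β i ^ 2) ≤ 100 * √(∑ i, DL U n (Fin.tail a) i (HH U v) ^ 2) := by
        apply Real.sqrt_le_iff.2
        have hq : 0 ≤ ∑ i, DL U n (Fin.tail a) i (HH U v) ^ 2 := Finset.sum_nonneg (fun _ _ => sq_nonneg _)
        refine ⟨by positivity, ?_⟩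
        rw [mul_pow, Real.sq_sqrt hq, Finset.mul_sum]
        apply Finset.sum_le_sum
        intro i _
        simp only [hβ]
        rw [mul_pow]
        apply mul_le_mul_of_nonneg_right _ (sq_nonneg _)
        have := kapd_nonneg (YY U v i)
        have := kapd_le (YY U v i)
        gcongr
      have hLn := LL_nonneg U n (Fin.tail a) (HH_box U v)
      have hfin : ∑ i, α i * ∑ l, U i l * β l ≤ √S * K * LL U n (Fin.tail a) (HH U v) := by
        refine (le_abs_self _).trans (hb.trans ?_)
        have := (hβn.trans (mul_le_mul_of_nonneg_left (IH v) (by norm_num : (0:ℝ) ≤ 100)))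
        calc δ * (√(∑ i, α i ^ 2) * √(∑ l, β l ^ 2)) ≤ δ * ((2500 * √S) * (100 * (25 * √D * (250000 * δ) ^ n * LL U n (Fin.tail a) (HH U v)))) := by
              gcongr
          _ = _ := by rw [hK]; ring
      calc _ ≤ PP (a 0) Z * (√S * K * LL U n (Fin.tail a) (HH U v)) := mul_le_mul_of_nonneg_left hfin hPPp.le
        _ = _ := by ring
    have hL0 := LL_nonneg U (n+1) a hY
    rcases eq_or_lt_of_le (Real.sqrt_nonneg S) with h0 | h0
    · rw [← h0]; positivity
    · have h5 : √S * √S ≤ √S * (K * LL U (n+1) a Y) := by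
        rw [Real.mul_self_sqrt hS0]; linarith
      exact le_of_mul_le_mul_left h5 h0

lemma sbox {s : ℝ} (h0 : 0 ≤ s) (h1 : s ≤ 1) : (fun _ => s) ∈ boxs N := by
  intro i; rw [abs_of_nonneg h0]; exact h1

lemma LL_line (n : ℕ) (a : Fin (n+1) → Fin N → Option Bool) (s : ℝ) :
    HasDerivAt (fun s => LL U n a (fun _ => s)) (∑ i, DL U n a i (fun _ => s)) s := by
  have h1 : HasDerivAt (fun s : ℝ => (fun _ : Fin N => s)) (fun _ => 1) s := by
    rw [hasDerivAt_pi]; intro i; exact hasDerivAt_id s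
  have := ((LL_good U n a).2.2 (fun _ => s)).comp_hasDerivAt s h1
  refine this.congr_deriv ?_
  simp [sum_apply]

lemma leaf_bound {D : ℕ} {δ : ℝ} (hδ : 0 ≤ δ) (hB : BilB U D δ) (n : ℕ) (a : Fin (n+1) → Fin N → Option Bool)
    (ha : tsup a ≤ D) :
    LL U n a (fun _ => 1) ≤ Real.exp (25 * D * (250000 * δ) ^ n) * LL U n a (fun _ => 0) := by
  set ε : ℝ := 25 * D * (250000 * δ) ^ n with hε
  have hd : ∀ s ∈ Set.Icc (0:ℝ) 1, ∑ i, DL U n a i (fun _ => s) ≤ ε * LL U n a (fun _ => s) := by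
    intro s hs
    have hY := sbox (N := N) hs.1 hs.2
    have h1 := grad_bound U hδ hB n a ha hY
    have hs0 : ((suppc (a 0)).card : ℝ) ≤ D := by
      have : (suppc (a 0)).card ≤ tsup a :=
        Finset.single_le_sum (f := fun b => (suppc (a b)).card) (fun _ _ => Nat.zero_le _) (Finset.mem_univ 0)
      exact_mod_cast this.trans ha
    have e1 : ∑ i, DL U n a i (fun _ => s) = ∑ i ∈ suppc (a 0), 1 * DL U n a i (fun _ => s) := by
      simp only [one_mul]
      symm
      apply Finset.sum_subset (Finset.subset_univ _)
      intro i _ hi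
      have : a 0 i = none := by simpa [mem_suppc] using hi
      exact DL_zero U n a this _
    rw [e1]
    refine (le_abs_self _).trans ((cs_abs _ _ _).trans ?_)
    have h2 : √(∑ i ∈ suppc (a 0), (1:ℝ) ^ 2) ≤ √D := by
      apply Real.sqrt_le_sqrt; simpa using hs0
    have h3 : √(∑ i ∈ suppc (a 0), DL U n a i (fun _ => s) ^ 2) ≤ √(∑ i, DL U n a i (fun _ => s) ^ 2) := by
      apply Real.sqrt_le_sqrt
      exact Finset.sum_le_sum_of_subset_of_nonneg (Finset.subset_univ _) (fun _ _ _ => sq_nonneg _)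
    calc _ ≤ √D * (25 * √D * (250000 * δ) ^ n * LL U n a (fun _ => s)) := by
          apply mul_le_mul h2 (h3.trans h1) (Real.sqrt_nonneg _) (Real.sqrt_nonneg _)
      _ = (√D * √D) * 25 * (250000 * δ) ^ n * LL U n a (fun _ => s) := by ring
      _ = _ := by rw [Real.mul_self_sqrt (by positivity), hε]; ring
  have hanti : AntitoneOn (fun s => LL U n a (fun _ => s) * Real.exp (-ε * s)) (Set.Icc 0 1) := by
    have hder : ∀ s, HasDerivAt (fun s => LL U n a (fun _ => s) * Real.exp (-ε * s))
        ((∑ i, DL U n a i (fun _ => s)) * Real.exp (-ε * s) + LL U n a (fun _ => s) * (Real.exp (-ε * s) * (-ε))) s := by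
      intro s
      apply (LL_line U n a s).mul
      have := ((hasDerivAt_id s).const_mul (-ε)).exp
      simpa using this
    apply antitoneOn_of_deriv_nonpos (convex_Icc 0 1)
    · exact fun s _ => (hder s).continuousAt.continuousWithinAt
    · exact fun s _ => (hder s).differentiableAt.differentiableWithinAt
    · intro s hs
      rw [interior_Icc] at hs
      rw [(hder s).deriv]
      have := hd s ⟨hs.1.le, hs.2.le⟩
      have he := Real.exp_pos (-ε * s)
      nlinarith
  have := hanti (Set.left_mem_Icc.2 zero_le_one) (Set.right_mem_Icc.2 zero_le_one) zero_le_one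
  simp only [mul_one, mul_zero, Real.exp_zero] at this
  rw [Real.exp_neg] at this
  have he := Real.exp_pos ε
  rw [← div_eq_mul_inv, div_le_iff₀ he] at this
  linarith

end grad
end Ror


namespace Ror

section trees
variable {N k : ℕ}

def upd (a : Fin k → Fin N → Option Bool) (q : Fin k × Fin N) (b : Bool) : Fin k → Fin N → Option Bool :=
  fun i j => if (i, j) = q then some b else a i j

lemma upd_self (a : Fin k → Fin N → Option Bool) (q : Fin k × Fin N) (b : Bool) : upd a q b q.1 q.2 = some b := by
  simp [upd]

lemma tsup_eq (a : Fin k → Fin N → Option Bool) : tsup a = ∑ p : Fin k × Fin N, if a p.1 p.2 ≠ none then 1 else 0 := by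
  unfold tsup suppc
  rw [Fintype.sum_prod_type]
  apply Finset.sum_congr rfl
  intro b _
  rw [Finset.card_filter]

lemma tsup_upd (a : Fin k → Fin N → Option Bool) (q : Fin k × Fin N) (b : Bool) : tsup (upd a q b) ≤ tsup a + 1 := by
  rw [tsup_eq, tsup_eq]
  have : ∑ p : Fin k × Fin N, ((if a p.1 p.2 ≠ none then 1 else 0) + if p = q then 1 else 0) =
      (∑ p : Fin k × Fin N, if a p.1 p.2 ≠ none then 1 else 0) + 1 := by
    rw [Finset.sum_add_distrib]; simp
  rw [← this]
  apply Finset.sum_le_sum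
  intro p _
  unfold upd
  by_cases h : p = q
  · simp [h]
  · have : ¬ ((p.1, p.2) = q) := by simpa using h
    simp [h]

noncomputable def leafsum (G : (Fin k → Fin N → Option Bool) → ℝ) :
    DTree (Fin k × Fin N) → (Fin k → Fin N → Option Bool) → ℝ
  | DTree.leaf b, a => (if b then 1 else 0) * G a
  | DTree.node q t0 t1, a =>
    match a q.1 q.2 with
    | some true => leafsum G t1 a
    | some false => leafsum G t0 a
    | none => leafsum G t0 (upd a q false) + leafsum G t1 (upd a q true)

lemma leafsum_mono {G1 G0 : (Fin k → Fin N → Option Bool) → ℝ} {c : ℝ} {D : ℕ}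
    (h : ∀ a, tsup a ≤ D → G1 a ≤ c * G0 a) (T : DTree (Fin k × Fin N)) (a : Fin k → Fin N → Option Bool)
    (ha : tsup a + T.depth ≤ D) : leafsum G1 T a ≤ c * leafsum G0 T a := by
  induction T generalizing a with
  | leaf b =>
    simp only [leafsum]
    have := h a (by omega)
    cases b <;> simp [this]
  | node q t0 t1 ih0 ih1 =>
    simp only [DTree.depth] at ha
    have hm0 := le_max_left t0.depth t1.depth
    have hm1 := le_max_right t0.depth t1.depth
    simp only [leafsum]
    split
    · exact ih1 a (by omega)
    · exact ih0 a (by omega)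
    · have h0 := tsup_upd a q false
      have h1 := tsup_upd a q true
      have := ih0 (upd a q false) (by omega)
      have := ih1 (upd a q true) (by omega)
      linarith

lemma leafsum_super {H Gs : (Fin k → Fin N → Option Bool) → ℝ} {D : ℕ}
    (h : ∀ a, tsup a ≤ D → |H a| ≤ Gs a)
    (hs : ∀ a q, a q.1 q.2 = none → Gs (upd a q false) + Gs (upd a q true) ≤ Gs a)
    (T : DTree (Fin k × Fin N)) (a : Fin k → Fin N → Option Bool)
    (ha : tsup a + T.depth ≤ D) : |leafsum H T a| ≤ Gs a := by
  induction T generalizing a with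
  | leaf b =>
    simp only [leafsum]
    have := h a (by omega)
    cases b
    · simpa using (abs_nonneg _).trans this
    · simpa using this
  | node q t0 t1 ih0 ih1 =>
    simp only [DTree.depth] at ha
    have hm0 := le_max_left t0.depth t1.depth
    have hm1 := le_max_right t0.depth t1.depth
    simp only [leafsum]
    split
    · exact ih1 a (by omega)
    · exact ih0 a (by omega)
    · rename_i hq
      have h0 := tsup_upd a q false
      have h1 := tsup_upd a q true
      have h2 := ih0 (upd a q false) (by omega)
      have h3 := ih1 (upd a q true) (by omega)
      exact (abs_add_le _ _).trans ((add_le_add h2 h3).trans (hs a q hq))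

lemma leafsum_deriv {G G' : ℝ → (Fin k → Fin N → Option Bool) → ℝ} {s : ℝ}
    (h : ∀ a, HasDerivAt (fun s => G s a) (G' s a) s) (T : DTree (Fin k × Fin N)) (a : Fin k → Fin N → Option Bool) :
    HasDerivAt (fun s => leafsum (G s) T a) (leafsum (G' s) T a) s := by
  induction T generalizing a with
  | leaf b => exact (h a).const_mul _
  | node q t0 t1 ih0 ih1 =>
    simp only [leafsum]
    rcases hq : a q.1 q.2 with _ | b
    · exact (ih0 _).add (ih1 _)
    · cases b
      · exact ih0 a
      · exact ih1 a

lemma leafsum_cont {X : Type*} [TopologicalSpace X] {G : X → (Fin k → Fin N → Option Bool) → ℝ}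
    (h : ∀ a, Continuous (fun s => G s a)) (T : DTree (Fin k × Fin N)) (a : Fin k → Fin N → Option Bool) :
    Continuous (fun s => leafsum (G s) T a) := by
  induction T generalizing a with
  | leaf b => exact continuous_const.mul (h a)
  | node q t0 t1 ih0 ih1 =>
    simp only [leafsum]
    rcases hq : a q.1 q.2 with _ | b
    · exact (ih0 _).add (ih1 _)
    · cases b
      · exact ih0 a
      · exact ih1 a

lemma leafsum_int {M : ℕ} {G : (Fin M → ℝ) → (Fin k → Fin N → Option Bool) → ℝ}
    (h : ∀ a, Continuous (fun s => G s a)) (T : DTree (Fin k × Fin N)) (a : Fin k → Fin N → Option Bool) :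
    leafsum (fun a => ∫ v, G v a ∂ppi M) T a = ∫ v, leafsum (G v) T a ∂ppi M := by
  induction T generalizing a with
  | leaf b => simp only [leafsum]; rw [integral_const_mul]
  | node q t0 t1 ih0 ih1 =>
    simp only [leafsum]
    rcases hq : a q.1 q.2 with _ | b
    · simp only
      rw [integral_add (ppi_integrable (leafsum_cont h _ _)) (ppi_integrable (leafsum_cont h _ _)), ih0, ih1]
    · cases b
      · exact ih0 a
      · exact ih1 a

def ind : Option Bool → Bool → ℝ
  | none, _ => 1
  | some b, c => if b = c then 1 else 0

noncomputable def indA (a : Fin k → Fin N → Option Bool) (z : Fin k → Fin N → Bool) : ℝ :=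
  ∏ p : Fin k × Fin N, ind (a p.1 p.2) (z p.1 p.2)

lemma indA_upd {a : Fin k → Fin N → Option Bool} {q : Fin k × Fin N} (hq : a q.1 q.2 = none) (b : Bool)
    (z : Fin k → Fin N → Bool) : indA (upd a q b) z = (if b = z q.1 q.2 then 1 else 0) * indA a z := by
  unfold indA
  rw [← Finset.mul_prod_erase Finset.univ _ (Finset.mem_univ q),
    ← Finset.mul_prod_erase Finset.univ (fun p : Fin k × Fin N => ind (a p.1 p.2) (z p.1 p.2)) (Finset.mem_univ q)]
  rw [upd_self, hq]
  simp only [ind, one_mul]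
  congr 1
  apply Finset.prod_congr rfl
  intro p hp
  have h := Finset.ne_of_mem_erase hp
  have : ¬ ((p.1, p.2) = q) := by simpa using h
  simp [upd, h]

lemma indA_zero {a : Fin k → Fin N → Option Bool} {q : Fin k × Fin N} {b : Bool} (hq : a q.1 q.2 = some b)
    {z : Fin k → Fin N → Bool} (hz : z q.1 q.2 ≠ b) : indA a z = 0 := by
  unfold indA
  apply Finset.prod_eq_zero (Finset.mem_univ q)
  rw [hq]; simp [ind, hz.symm]

lemma leafsum_eval (W : (Fin k → Fin N → Bool) → ℝ) (T : DTree (Fin k × Fin N)) (a : Fin k → Fin N → Option Bool) :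
    ∑ z, W z * (indA a z * T.eval (fun p => z p.1 p.2)) = leafsum (fun a => ∑ z, W z * indA a z) T a := by
  induction T generalizing a with
  | leaf b =>
    simp only [leafsum, DTree.eval]
    rw [Finset.mul_sum]
    apply Finset.sum_congr rfl
    intros; ring
  | node q t0 t1 ih0 ih1 =>
    simp only [leafsum]
    rcases hq : a q.1 q.2 with _ | b
    · simp only
      rw [← ih0, ← ih1, ← Finset.sum_add_distrib]
      apply Finset.sum_congr rfl
      intro z _
      rw [indA_upd hq, indA_upd hq]
      simp only [DTree.eval]
      rcases Bool.eq_false_or_eq_true (z q.1 q.2) with hz | hz <;> simp [hz]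
    · cases b
      · simp only
        rw [← ih0]
        apply Finset.sum_congr rfl
        intro z _
        by_cases hz : z q.1 q.2 = false
        · simp [DTree.eval, hz]
        · rw [indA_zero hq hz]; simp
      · simp only
        rw [← ih1]
        apply Finset.sum_congr rfl
        intro z _
        by_cases hz : z q.1 q.2 = true
        · simp [DTree.eval, hz]
        · rw [indA_zero hq hz]; simp

end trees

section expectation
variable {N : ℕ} (U : Fin N → Fin N → ℝ)

/-- pseudo-density of the distribution -/
noncomputable def DD (n : ℕ) (Y : Fin N → ℝ) (z : Fin (n+1) → Fin N → Bool) : ℝ :=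
  LL U n (fun b j => some (z b j)) Y

lemma DD_nonneg (n : ℕ) {Y : Fin N → ℝ} (hY : Y ∈ boxs N) (z : Fin (n+1) → Fin N → Bool) : 0 ≤ DD U n Y z :=
  LL_nonneg U n _ hY

noncomputable def EE (n : ℕ) (f : (Fin (n+1) → Fin N → Bool) → ℝ) (Y : Fin N → ℝ) : ℝ := ∑ z, DD U n Y z * f z

lemma sum_cons {n : ℕ} (f : (Fin (n+1) → Fin N → Bool) → ℝ) :
    ∑ z, f z = ∑ x : Fin N → Bool, ∑ z' : Fin n → Fin N → Bool, f (Fin.cons x z') := by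
  rw [← Fintype.sum_prod_type']
  symm
  exact Fintype.sum_equiv (Fin.consEquiv (fun _ => Fin N → Bool)) _ _ (fun p => rfl)

noncomputable def E1 (f : (Fin N → Bool) → ℝ) (Z : Fin N → ℝ) : ℝ := ∑ x, PP (fun i => some (x i)) Z * f x

lemma E1_cont (f : (Fin N → Bool) → ℝ) : Continuous (E1 f) := by
  unfold E1
  have := fun o : Fin N → Option Bool => PP_cont o
  fun_prop

lemma EE_cont (n : ℕ) (f : (Fin (n+1) → Fin N → Bool) → ℝ) : Continuous (EE U n f) := by
  unfold EE DD
  have := fun o => (LL_good U n o).1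
  fun_prop

lemma EE_zero (f : (Fin 1 → Fin N → Bool) → ℝ) (Y : Fin N → ℝ) :
    EE U 0 f Y = E1 (fun x => f (fun _ => x)) (fun i => rho * Y i) := by
  unfold EE E1
  rw [sum_cons]
  apply Finset.sum_congr rfl
  intro x _
  rw [Fintype.sum_unique]
  have : (Fin.cons x (default : Fin 0 → Fin N → Bool) : Fin 1 → Fin N → Bool) = fun _ => x := by
    funext i; have hi : i = 0 := Fin.fin_one_eq_zero i
    rw [hi]; rfl
  have this2 : ∀ w : Fin 0 → Fin N → Bool, (Fin.cons x w : Fin 1 → Fin N → Bool) = fun _ => x := by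
    intro w; rw [← this]; congr 1; exact Subsingleton.elim _ _
  rw [this2]; rfl

lemma EE_succ (n : ℕ) (f : (Fin (n+2) → Fin N → Bool) → ℝ) (Y : Fin N → ℝ) :
    EE U (n+1) f Y = ∫ v, E1 (fun x => EE U n (fun z => f (Fin.cons x z)) (HH U v)) (fun i => rho * (Y i * kap (v i))) ∂ppi N := by
  have hk := kap_cont
  have hH := HH_cont U
  have hP : ∀ o : Fin N → Option Bool, Continuous (fun v : Fin N → ℝ => PP o (fun i => rho * (Y i * kap (v i)))) :=
    fun i => (PP_cont _).comp (by fun_prop)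
  have hL := fun o => (LL_good U n o).1
  unfold EE E1
  rw [sum_cons]
  rw [integral_finsetSum _ (fun x _ => ppi_integrable (by unfold DD; fun_prop))]
  apply Finset.sum_congr rfl
  intro x _
  simp_rw [Finset.mul_sum]
  rw [integral_finsetSum _ (fun x _ => ppi_integrable (by unfold DD; fun_prop))]
  apply Finset.sum_congr rfl
  intro z _
  rw [DD, LL, ← integral_mul_const]
  congr 1
  ext v
  rw [mul_assoc]
  rfl

lemma E1_ind (o : Fin N → Option Bool) (Z : Fin N → ℝ) :
    E1 (fun x => ∏ i, ind (o i) (x i)) Z = PP o Z := by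
  unfold E1 PP
  simp_rw [← Finset.prod_mul_distrib]
  have : ∀ i, pf (o i) (Z i) = ∑ b : Bool, pf (some b) (Z i) * ind (o i) b := by
    intro i
    rcases o i with _ | b
    · simp [pf, ind, sg]; ring
    · cases b <;> simp [pf, ind, sg]
  simp_rw [this]
  rw [Finset.prod_univ_sum, Fintype.piFinset_univ]

lemma EE_ind (n : ℕ) (a : Fin (n+1) → Fin N → Option Bool) (Y : Fin N → ℝ) :
    EE U n (indA a) Y = LL U n a Y := by
  induction n generalizing Y with
  | zero =>
    rw [EE_zero, LL, ← E1_ind]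
    congr 1
    ext x
    unfold indA
    rw [Fintype.prod_prod_type]
    simp
  | succ n ih =>
    rw [EE_succ, LL]
    congr 1
    ext v
    rw [← ih, ← E1_ind]
    unfold E1
    rw [Finset.sum_mul]
    apply Finset.sum_congr rfl
    intro x _
    rw [mul_assoc]
    congr 1
    unfold EE
    rw [Finset.mul_sum]
    apply Finset.sum_congr rfl
    intro z _
    have e : indA a (Fin.cons x z) = (∏ i, ind (a 0 i) (x i)) * indA (Fin.tail a) z := by
      unfold indA
      rw [Fintype.prod_prod_type, Fin.prod_univ_succ]
      congr 1
      rw [Fintype.prod_prod_type]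
      rfl
    simp only [e]
    ring

lemma indA_none {k : ℕ} (z : Fin k → Fin N → Bool) : indA (fun _ _ => none) z = 1 := by
  simp [indA, ind]

lemma LL_none (n : ℕ) (Y : Fin N → ℝ) : LL U n (fun _ _ => none) Y = 1 := by
  induction n generalizing Y with
  | zero => simp [LL, PP, pf]
  | succ n ih =>
    have e : (Fin.tail (fun _ _ => none) : Fin (n+1) → Fin N → Option Bool) = fun _ _ => none := rfl
    simp only [LL, e, ih]
    simp [PP, pf]

lemma EE_one (n : ℕ) (Y : Fin N → ℝ) : EE U n (fun _ => 1) Y = 1 := by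
  have h := EE_ind U n (fun _ _ => none) Y
  rw [LL_none] at h
  have e : (fun _ : Fin (n+1) → Fin N → Bool => (1:ℝ)) = indA (fun _ _ => none) := by
    ext z; rw [indA_none]
  rw [e]; exact h

lemma EE_tree (n : ℕ) (T : DTree (Fin (n+1) × Fin N)) (Y : Fin N → ℝ) :
    EE U n (fun z => T.eval (fun p => z p.1 p.2)) Y = leafsum (fun a => LL U n a Y) T (fun _ _ => none) := by
  have := leafsum_eval (DD U n Y) T (fun _ _ => none)
  simp only [indA_none, one_mul] at this
  unfold EE
  rw [this]
  congr 1
  ext a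
  exact EE_ind U n a Y

lemma tsup_none {k : ℕ} : tsup (N := N) (fun (_ : Fin k) _ => none) = 0 := by
  rw [tsup_eq]; simp

lemma tree_mult {D : ℕ} {δ : ℝ} (hδ : 0 ≤ δ) (hB : BilB U D δ) (n : ℕ) (T : DTree (Fin (n+1) × Fin N))
    (hT : T.depth ≤ D) :
    EE U n (fun z => T.eval (fun p => z p.1 p.2)) (fun _ => 1) ≤
      Real.exp (25 * D * (250000 * δ) ^ n) * EE U n (fun z => T.eval (fun p => z p.1 p.2)) (fun _ => 0) := by
  rw [EE_tree, EE_tree]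
  apply leafsum_mono (D := D) (fun a ha => leaf_bound U hδ hB n a ha)
  rw [tsup_none]; omega

end expectation
end Ror


namespace Ror

section ktwo
variable {N : ℕ}

noncomputable def Phi (U : Fin N → Fin N → ℝ) (x y : Fin N → ℝ) : ℝ :=
  (∑ i, x i * ∑ l, U i l * y l) ^ 2 - ∑ i, x i ^ 2 * (∑ l, U i l * y l) ^ 2
    - ∑ l, y l ^ 2 * (∑ i, U i l * x i) ^ 2

lemma Msymm (U : Fin N → Fin N → ℝ) (x y : Fin N → ℝ) :
    ∑ i, x i * ∑ l, U i l * y l = ∑ l, y l * ∑ i, U i l * x i := by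
  simp_rw [Finset.mul_sum]
  rw [Finset.sum_comm]
  apply Finset.sum_congr rfl
  intro l _
  apply Finset.sum_congr rfl
  intros; ring

lemma Phi_symm (U : Fin N → Fin N → ℝ) (x y : Fin N → ℝ) : Phi U x y = Phi (fun l i => U i l) y x := by
  unfold Phi
  rw [Msymm]; ring

lemma sum_upd (F : ℝ → Fin N → ℝ) (x : Fin N → ℝ) (i0 : Fin N) (t : ℝ) :
    ∑ i, F (Function.update x i0 t i) i = ∑ i, F (x i) i + (F t i0 - F (x i0) i0) := by
  rw [← Finset.add_sum_erase _ _ (Finset.mem_univ i0), ← Finset.add_sum_erase _ (fun i => F (x i) i) (Finset.mem_univ i0)]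
  have : ∑ i ∈ Finset.univ.erase i0, F (Function.update x i0 t i) i = ∑ i ∈ Finset.univ.erase i0, F (x i) i := by
    apply Finset.sum_congr rfl
    intro j hj
    rw [Function.update_of_ne (Finset.ne_of_mem_erase hj)]
  rw [this, Function.update_self]; ring

lemma Phi_upd (U : Fin N → Fin N → ℝ) (x y : Fin N → ℝ) (i0 : Fin N) (h0 : x i0 = 0) :
    ∃ c, ∀ t, Phi U (Function.update x i0 t) y ≤ Phi U x y + t * c := by
  set M := ∑ i, x i * ∑ l, U i l * y l with hM
  set R := ∑ l, U i0 l * y l with hR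
  refine ⟨2 * M * R - ∑ l, y l ^ 2 * (2 * (U i0 l * ∑ i, U i l * x i)), fun t => ?_⟩
  unfold Phi
  have e1 := sum_upd (fun s i => s * ∑ l, U i l * y l) x i0 t
  have e2 := sum_upd (fun s i => s ^ 2 * (∑ l, U i l * y l) ^ 2) x i0 t
  have e3 := fun l => sum_upd (fun s i => U i l * s) x i0 t
  simp only [h0] at e1 e2 e3
  rw [e1, e2, ← hM, ← hR]
  simp_rw [e3]
  have e4 : ∑ l, y l ^ 2 * (∑ i, U i l * x i + (U i0 l * t - U i0 l * 0)) ^ 2 =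
      ∑ l, y l ^ 2 * (∑ i, U i l * x i) ^ 2 + t * ∑ l, y l ^ 2 * (2 * (U i0 l * ∑ i, U i l * x i))
        + t ^ 2 * ∑ l, y l ^ 2 * U i0 l ^ 2 := by
    rw [Finset.mul_sum, Finset.mul_sum, ← Finset.sum_add_distrib, ← Finset.sum_add_distrib]
    apply Finset.sum_congr rfl
    intros; ring
  rw [e4]
  have h5 : 0 ≤ t ^ 2 * ∑ l, y l ^ 2 * U i0 l ^ 2 :=
    mul_nonneg (sq_nonneg _) (Finset.sum_nonneg (fun _ _ => by positivity))
  nlinarith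

noncomputable def xw (A Z : Fin N → ℝ) (o : Fin N → Option Bool) (i : Fin N) : ℝ := A i * wt (o i) (Z i)

noncomputable def GS (K : ℝ) (U : Fin N → Fin N → ℝ) (A B Z0 Z1 : Fin N → ℝ) (o0 o1 : Fin N → Option Bool) : ℝ :=
  PP o0 Z0 * PP o1 Z1 * ((2 * K + Phi U (xw A Z0 o0) (xw B Z1 o1) / K) / 2)

lemma GS_symm (K : ℝ) (U : Fin N → Fin N → ℝ) (A B Z0 Z1 : Fin N → ℝ) (o0 o1 : Fin N → Option Bool) :
    GS K U A B Z0 Z1 o0 o1 = GS K (fun l i => U i l) B A Z1 Z0 o1 o0 := by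
  unfold GS
  rw [Phi_symm]; ring

lemma PP_set {o : Fin N → Option Bool} {i : Fin N} (hi : o i = none) (b : Bool) (Z : Fin N → ℝ) :
    PP (Function.update o i (some b)) Z = pf (some b) (Z i) * PP o Z := by
  unfold PP
  rw [← Finset.mul_prod_erase Finset.univ _ (Finset.mem_univ i),
    ← Finset.mul_prod_erase Finset.univ (fun j => pf (o j) (Z j)) (Finset.mem_univ i)]
  rw [Function.update_self, hi]
  have : ∏ j ∈ Finset.univ.erase i, pf (Function.update o i (some b) j) (Z j) = ∏ j ∈ Finset.univ.erase i, pf (o j) (Z j) := by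
    apply Finset.prod_congr rfl
    intro j hj
    rw [Function.update_of_ne (Finset.ne_of_mem_erase hj)]
  rw [this]; simp [pf]

lemma xw_set (A Z : Fin N → ℝ) {o : Fin N → Option Bool} {i : Fin N} (b : Bool) :
    xw A Z (Function.update o i (some b)) = Function.update (xw A Z o) i (A i * wt (some b) (Z i)) := by
  ext j
  by_cases h : j = i
  · subst h; simp [xw]
  · simp [xw, h]

lemma GS_super {K : ℝ} (hK : 0 < K) (U : Fin N → Fin N → ℝ) (A B Z0 Z1 : Fin N → ℝ) (o0 o1 : Fin N → Option Bool)
    (h0 : ∀ i, |Z0 i| ≤ rho) (h1 : ∀ i, |Z1 i| ≤ rho) {i : Fin N} (hi : o0 i = none) :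
    GS K U A B Z0 Z1 (Function.update o0 i (some false)) o1 + GS K U A B Z0 Z1 (Function.update o0 i (some true)) o1
      ≤ GS K U A B Z0 Z1 o0 o1 := by
  obtain ⟨c, hc⟩ := Phi_upd U (xw A Z0 o0) (xw B Z1 o1) i (by simp [xw, hi, wt_none])
  unfold GS
  rw [PP_set hi, PP_set hi, xw_set, xw_set]
  have pf0 := pf_pos (o := some false) (h0 i)
  have pf1 := pf_pos (o := some true) (h0 i)
  have P0 := PP_pos (o := o0) h0
  have P1 := PP_pos (o := o1) h1
  have c0 := hc (A i * wt (some false) (Z0 i))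
  have c1 := hc (A i * wt (some true) (Z0 i))
  set F0 := Phi U (Function.update (xw A Z0 o0) i (A i * wt (some false) (Z0 i))) (xw B Z1 o1)
  set F1 := Phi U (Function.update (xw A Z0 o0) i (A i * wt (some true) (Z0 i))) (xw B Z1 o1)
  set F := Phi U (xw A Z0 o0) (xw B Z1 o1)
  set p0 := pf (some false) (Z0 i) with hp0
  set p1 := pf (some true) (Z0 i) with hp1
  have hs : p0 + p1 = 1 := by simp [hp0, hp1, pf, sg]; ring
  have w0 : p0 * wt (some false) (Z0 i) = -1/2 := by
    unfold wt; rw [← hp0]; field_simp; simp [sgo, sg]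
  have w1 : p1 * wt (some true) (Z0 i) = 1/2 := by
    unfold wt; rw [← hp1]; field_simp; simp [sgo, sg]
  have hsum : p0 * F0 + p1 * F1 ≤ F := by
    have a0 := mul_le_mul_of_nonneg_left c0 pf0.le
    have a1 := mul_le_mul_of_nonneg_left c1 pf1.le
    have e : p0 * (F + A i * wt (some false) (Z0 i) * c) + p1 * (F + A i * wt (some true) (Z0 i) * c)
      = (p0 + p1) * F + A i * c * (p0 * wt (some false) (Z0 i) + p1 * wt (some true) (Z0 i)) := by ring
    rw [hs, w0, w1] at e
    linarith
  have hdiv := div_le_div_of_nonneg_right hsum hK.le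
  have e : p0 * PP o0 Z0 * PP o1 Z1 * ((2 * K + F0 / K) / 2) + p1 * PP o0 Z0 * PP o1 Z1 * ((2 * K + F1 / K) / 2)
    = PP o0 Z0 * PP o1 Z1 * ((2 * K * (p0 + p1) + (p0 * F0 + p1 * F1) / K) / 2) := by ring
  rw [e, hs, mul_one]
  apply mul_le_mul_of_nonneg_left _ (by positivity)
  linarith

lemma V_half {U : Fin N → Fin N → ℝ} {D : ℕ} {δ : ℝ} (hδ : 0 ≤ δ) (hB : BilB U D δ) {S T : Finset (Fin N)}
    (hST : S.card + T.card ≤ D) {x y : Fin N → ℝ} (hx : ∀ i, |x i| ≤ 2500) (hy : ∀ i, |y i| ≤ 2500)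
    (hxS : ∀ i, i ∉ S → x i = 0) (hyT : ∀ i, i ∉ T → y i = 0) :
    ∑ i, x i ^ 2 * (∑ l, U i l * y l) ^ 2 ≤ 2500 ^ 4 * (δ ^ 2 * D) := by
  set R : Fin N → ℝ := fun i => ∑ l, U i l * y l with hR
  set α : Fin N → ℝ := fun i => if i ∈ S then R i else 0 with hα
  have hsq : ∀ s : ℝ, |s| ≤ 2500 → s ^ 2 ≤ 2500 ^ 2 := by
    intro s hs; rw [← sq_abs]; gcongr
  have h1 := hB S T α y hST (by intro i hi; simp [hα, hi]) hyT
  have e1 : ∑ i, α i * ∑ l, U i l * y l = ∑ i, α i ^ 2 := by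
    apply Finset.sum_congr rfl
    intro i _
    simp only [hα, hR]
    split_ifs <;> ring
  have hn : 0 ≤ ∑ i, α i ^ 2 := Finset.sum_nonneg (fun _ _ => sq_nonneg _)
  have hyn : 0 ≤ ∑ i, y i ^ 2 := Finset.sum_nonneg (fun _ _ => sq_nonneg _)
  rw [e1, abs_of_nonneg hn] at h1
  have h2 : ∑ i, α i ^ 2 ≤ δ ^ 2 * ∑ i, y i ^ 2 := by
    have s1 := Real.sq_sqrt hn
    have s2 := Real.sq_sqrt hyn
    have p1 := Real.sqrt_nonneg (∑ i, α i ^ 2)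
    have p2 := Real.sqrt_nonneg (∑ i, y i ^ 2)
    set a := √(∑ i, α i ^ 2)
    set b := √(∑ i, y i ^ 2)
    rw [← s1, ← s2]
    rw [← s1] at h1
    have : a ≤ δ * b := by
      rcases eq_or_lt_of_le p1 with h | h
      · rw [← h]; positivity
      · apply le_of_mul_le_mul_left _ h
        nlinarith
    rw [← mul_pow]
    gcongr
  have h3 : ∑ i, y i ^ 2 ≤ 2500 ^ 2 * D := by
    rw [← Finset.sum_subset (Finset.subset_univ T)]
    · refine (Finset.sum_le_card_nsmul _ _ (2500 ^ 2) (fun i _ => hsq _ (hy i))).trans ?_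
      rw [nsmul_eq_mul, mul_comm]
      have : (T.card : ℝ) ≤ D := by exact_mod_cast (by omega : T.card ≤ D)
      gcongr
    · intro i _ hi; rw [hyT i hi]; ring
  calc ∑ i, x i ^ 2 * R i ^ 2 ≤ ∑ i, 2500 ^ 2 * α i ^ 2 := by
        apply Finset.sum_le_sum
        intro i _
        simp only [hα]
        split_ifs with h
        · exact mul_le_mul_of_nonneg_right (hsq _ (hx i)) (sq_nonneg _)
        · rw [hxS i h]; simp
    _ = 2500 ^ 2 * ∑ i, α i ^ 2 := by rw [Finset.mul_sum]
    _ ≤ 2500 ^ 2 * (δ ^ 2 * (2500 ^ 2 * D)) := by gcongr; exact h2.trans (by gcongr)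
    _ = _ := by ring

lemma bil_symm {U : Fin N → Fin N → ℝ} {D : ℕ} {δ : ℝ} (hB : BilB U D δ) : BilB (fun l i => U i l) D δ := by
  intro S T α β h hα hβ
  have := hB T S β α (by omega) hβ hα
  rw [Msymm] at this
  rw [mul_comm (√(∑ i, α i ^ 2))]
  exact this

lemma GS_ge {K : ℝ} (hK : 0 < K) {U : Fin N → Fin N → ℝ} {D : ℕ} {δ : ℝ} (hδ : 0 ≤ δ) (hB : BilB U D δ)
    (hKD : 2 * (2500 ^ 4 * (δ ^ 2 * D)) ≤ K ^ 2) (A B Z0 Z1 : Fin N → ℝ) (o0 o1 : Fin N → Option Bool)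
    (hD : (suppc o0).card + (suppc o1).card ≤ D)
    (h0 : ∀ i, |Z0 i| ≤ rho) (h1 : ∀ i, |Z1 i| ≤ rho) (hA : ∀ i, |A i| ≤ 100) (hBB : ∀ i, |B i| ≤ 100) :
    |PP o0 Z0 * PP o1 Z1 * ∑ i, xw A Z0 o0 i * ∑ l, U i l * xw B Z1 o1 l| ≤ GS K U A B Z0 Z1 o0 o1 := by
  have P0 := PP_pos (o := o0) h0
  have P1 := PP_pos (o := o1) h1
  have bx : ∀ (A Z : Fin N → ℝ) (o : Fin N → Option Bool), (∀ i, |Z i| ≤ rho) → (∀ i, |A i| ≤ 100) → ∀ i, |xw A Z o i| ≤ 2500 := by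
    intro A Z o hZ hA i
    unfold xw
    rw [abs_mul]
    calc _ ≤ (100:ℝ) * 25 := by
          have := hA i; have := wt_abs (o := o i) (hZ i); gcongr
      _ = 2500 := by norm_num
  have zx : ∀ (A Z : Fin N → ℝ) (o : Fin N → Option Bool), ∀ i, i ∉ suppc o → xw A Z o i = 0 := by
    intro A Z o i hi
    have : o i = none := by simpa [mem_suppc] using hi
    simp [xw, this, wt_none]
  have v1 := V_half hδ hB hD (bx A Z0 o0 h0 hA) (bx B Z1 o1 h1 hBB) (zx A Z0 o0) (zx B Z1 o1)
  have v2 := V_half hδ (bil_symm hB) (by omega) (bx B Z1 o1 h1 hBB) (bx A Z0 o0 h0 hA) (zx B Z1 o1) (zx A Z0 o0)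
  unfold GS
  rw [abs_mul, abs_of_pos (mul_pos P0 P1)]
  apply mul_le_mul_of_nonneg_left _ (by positivity)
  unfold Phi
  set M := ∑ i, xw A Z0 o0 i * ∑ l, U i l * xw B Z1 o1 l
  set V1 := ∑ i, xw A Z0 o0 i ^ 2 * (∑ l, U i l * xw B Z1 o1 l) ^ 2
  set V2 := ∑ l, xw B Z1 o1 l ^ 2 * (∑ i, U i l * xw A Z0 o0 i) ^ 2
  have hM : |M| = 2 * K * |M| / K / 2 := by field_simp
  have : 2 * K + (M ^ 2 - V1 - V2) / K = (2 * K ^ 2 + (M ^ 2 - V1 - V2)) / K := by field_simp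
  rw [this, hM]
  apply div_le_div_of_nonneg_right _ (by norm_num)
  apply div_le_div_of_nonneg_right _ hK.le
  have := sq_abs M
  nlinarith [sq_nonneg (|M| - K)]

lemma upd0 (a : Fin 2 → Fin N → Option Bool) (i : Fin N) (b : Bool) :
    upd a (0, i) b 0 = Function.update (a 0) i (some b) ∧ upd a (0, i) b 1 = a 1 := by
  constructor
  · ext1 j; by_cases h : j = i <;> simp [upd, h]
  · ext1 j; simp [upd]

lemma upd1 (a : Fin 2 → Fin N → Option Bool) (i : Fin N) (b : Bool) :
    upd a (1, i) b 1 = Function.update (a 1) i (some b) ∧ upd a (1, i) b 0 = a 0 := by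
  constructor
  · ext1 j; by_cases h : j = i <;> simp [upd, h]
  · ext1 j; simp [upd]

lemma two_deriv {U : Fin N → Fin N → ℝ} {D : ℕ} {δ K : ℝ} (hK : 0 < K) (hδ : 0 ≤ δ) (hB : BilB U D δ)
    (hKD : 2 * (2500 ^ 4 * (δ ^ 2 * D)) ≤ K ^ 2) (T : DTree (Fin 2 × Fin N)) (hT : T.depth ≤ D)
    {s : ℝ} (hs0 : 0 ≤ s) (hs1 : s ≤ 1) :
    |leafsum (fun a => ∑ i, DL U 1 a i (fun _ => s)) T (fun _ _ => none)| ≤ K := by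
  have hk := kap_cont
  have hkd := kapd_cont
  have hKc := Kk_cont
  have hH := HH_cont U
  have hYc := YY_cont U
  have hY := sbox (N := N) hs0 hs1
  have hP : ∀ (o : Fin N → Option Bool) i, Continuous (fun v : Fin N → ℝ => PD o i (fun i => rho * (s * kap (v i)))) :=
    fun o i => (PD_cont _ _).comp (by fun_prop)
  set G : (Fin N → ℝ) → (Fin 2 → Fin N → Option Bool) → ℝ := fun v a =>
    ∑ i, (rho * Kk (v i) * kapd (v i)) * PD (a 0) i (fun i => rho * (s * kap (v i))) *
      ∑ l, U i l * (kapd (YY U v l) * DL U 0 (Fin.tail a) l (HH U v)) with hG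
  have hDc := fun a : Fin 1 → Fin N → Option Bool => (LL_good U 0 a).2.1
  have hGc : ∀ a, Continuous (fun v => G v a) := by
    intro a
    simp only [hG]
    have := hP (a 0)
    have := hDc (Fin.tail a)
    fun_prop
  have e1 : (fun a => ∑ i, DL U 1 a i (fun _ => s)) = fun a => ∫ v, G v a ∂ppi N := by
    ext a
    rw [hG, integral_finsetSum]
    · apply Finset.sum_congr rfl
      intro i _
      exact DL_ibp U 0 a i (fun _ => s)
    · intro i _
      apply ppi_integrable
      have := hP (a 0)
      have := hDc (Fin.tail a)
      fun_prop
  rw [e1, leafsum_int hGc]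
  have hpt : ∀ v ∈ boxs N, |leafsum (G v) T (fun _ _ => none)| ≤ K := by
    intro v hv
    set Z0 : Fin N → ℝ := fun i => rho * (s * kap (v i)) with hZ0
    set Z1 : Fin N → ℝ := fun i => rho * HH U v i with hZ1
    set A : Fin N → ℝ := fun i => rho * Kk (v i) * kapd (v i) with hA
    set B : Fin N → ℝ := fun l => rho * kapd (YY U v l) with hBd
    have z0 : ∀ i, |Z0 i| ≤ rho := fun i => rYk hY i (v i)
    have z1 : ∀ i, |Z1 i| ≤ rho := fun i => rY (HH_box U v) i
    have hr0 : (0:ℝ) ≤ rho := by unfold rho; norm_num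
    have hr1 : rho ≤ 1 := by unfold rho; norm_num
    have bA : ∀ i, |A i| ≤ 100 := by
      intro i
      have k0 := Kk_nonneg (hv i)
      have k1 := Kk_le (v i)
      have d0 := kapd_nonneg (v i)
      have d1 := kapd_le (v i)
      rw [abs_of_nonneg (by positivity)]
      calc _ ≤ (1:ℝ) * 1 * 100 := by simp only [hA]; gcongr
        _ = 100 := by norm_num
    have bB : ∀ i, |B i| ≤ 100 := by
      intro i
      have d0 := kapd_nonneg (YY U v i)
      have d1 := kapd_le (YY U v i)
      rw [abs_of_nonneg (by positivity)]
      calc _ ≤ (1:ℝ) * 100 := by simp only [hBd]; gcongr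
        _ = 100 := by norm_num
    have hGv : ∀ a, G v a = PP (a 0) Z0 * PP (a 1) Z1 * ∑ i, xw A Z0 (a 0) i * ∑ l, U i l * xw B Z1 (a 1) l := by
      intro a
      simp only [hG]
      rw [Finset.mul_sum]
      apply Finset.sum_congr rfl
      intro i _
      have e2 : ∑ l, U i l * (kapd (YY U v l) * DL U 0 (Fin.tail a) l (HH U v)) =
          PP (a 1) Z1 * ∑ l, U i l * xw B Z1 (a 1) l := by
        rw [Finset.mul_sum]
        apply Finset.sum_congr rfl
        intro l _
        have : DL U 0 (Fin.tail a) l (HH U v) = rho * PD (a 1) l Z1 := rfl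
        rw [this, PD_eq (z1 l)]
        simp only [xw, hBd]; ring
      rw [e2]
      have : PD (a 0) i (fun i => rho * (s * kap (v i))) = wt (a 0 i) (Z0 i) * PP (a 0) Z0 := PD_eq (z0 i)
      rw [this]
      simp only [xw, hA]; ring
    have fin := leafsum_super (H := G v) (Gs := fun a => GS K U A B Z0 Z1 (a 0) (a 1)) (D := D)
      (by
        intro a ha
        rw [hGv]
        apply GS_ge hK hδ hB hKD A B Z0 Z1 _ _ _ z0 z1 bA bB
        have : tsup a = (suppc (a 0)).card + (suppc (a 1)).card := by
          unfold tsup; rw [Fin.sum_univ_two]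
        omega)
      (by
        rintro a ⟨b, i⟩ hq
        match b, hq with
        | 0, hq =>
          simp only [(upd0 a i _).1, (upd0 a i _).2]
          exact GS_super hK U A B Z0 Z1 _ _ z0 z1 hq
        | 1, hq =>
          simp only [(upd1 a i _).1, (upd1 a i _).2]
          rw [GS_symm, GS_symm K U A B Z0 Z1 (a 0) (Function.update _ _ _), GS_symm K U A B Z0 Z1 (a 0) (a 1)]
          exact GS_super hK _ B A Z1 Z0 _ _ z1 z0 hq)
      T (fun _ _ => none) (by rw [tsup_none]; omega)
    refine fin.trans (le_of_eq ?_)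
    simp only [GS]
    have : xw A Z0 (fun _ => none) = fun _ => 0 := by ext i; simp [xw, wt_none]
    rw [this]
    simp [PP, pf, Phi]
  calc |∫ v, leafsum (G v) T (fun _ _ => none) ∂ppi N| ≤ ∫ v, |leafsum (G v) T (fun _ _ => none)| ∂ppi N :=
        abs_integral_le_integral_abs
    _ ≤ ∫ _, K ∂ppi N := by
        apply ppi_mono (leafsum_cont hGc _ _).abs continuous_const hpt
    _ = K := by simp

lemma tree_two {U : Fin N → Fin N → ℝ} {D : ℕ} {δ K : ℝ} (hK : 0 < K) (hδ : 0 ≤ δ) (hB : BilB U D δ)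
    (hKD : 2 * (2500 ^ 4 * (δ ^ 2 * D)) ≤ K ^ 2) (T : DTree (Fin 2 × Fin N)) (hT : T.depth ≤ D) :
    EE U 1 (fun z => T.eval (fun p => z p.1 p.2)) (fun _ => 1) ≤
      EE U 1 (fun z => T.eval (fun p => z p.1 p.2)) (fun _ => 0) + K := by
  rw [EE_tree, EE_tree]
  have hd : ∀ s, HasDerivAt (fun s => leafsum (fun a => LL U 1 a (fun _ => s)) T (fun _ _ => none))
      (leafsum (fun a => ∑ i, DL U 1 a i (fun _ => s)) T (fun _ _ => none)) s := by
    intro s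
    exact leafsum_deriv (G := fun s a => LL U 1 a (fun _ => s)) (G' := fun s a => ∑ i, DL U 1 a i (fun _ => s)) (fun a => LL_line U 1 a s) T _
  have := norm_image_sub_le_of_norm_deriv_le_segment_01' (C := K) (fun s _ => (hd s).hasDerivWithinAt)
    (fun s hs => two_deriv hK hδ hB hKD T hT hs.1 hs.2.le)
  rw [Real.norm_eq_abs] at this
  have := (abs_le.1 this).2
  linarith

end ktwo
end Ror


namespace Ror

section phifacts
variable {N : ℕ} (U : Fin N → Fin N → ℝ)

noncomputable def rr : (n : ℕ) → (Fin (n+1) → Fin N → ℝ) → Fin N → ℝ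
  | 0, z => z 0
  | n+1, z => fun i => z 0 i * ∑ j, U i j * rr n (Fin.tail z) j

noncomputable def WW (n : ℕ) (z : Fin (n+1) → Fin N → ℝ) (i : Fin (n+1) → Fin N) : ℝ :=
  (∏ a, z a (i a)) * ∏ b : Fin n, U (i b.castSucc) (i b.succ)

lemma sum_consN {n : ℕ} (f : (Fin (n+1) → Fin N) → ℝ) :
    ∑ z, f z = ∑ x : Fin N, ∑ z' : Fin n → Fin N, f (Fin.cons x z') := by
  rw [← Fintype.sum_prod_type']
  symm
  exact Fintype.sum_equiv (Fin.consEquiv (fun _ => Fin N)) _ _ (fun p => rfl)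

lemma WW_cons (n : ℕ) (z : Fin (n+2) → Fin N → ℝ) (i0 : Fin N) (i' : Fin (n+1) → Fin N) :
    WW U (n+1) z (Fin.cons i0 i') = z 0 i0 * (U i0 (i' 0) * WW U n (Fin.tail z) i') := by
  unfold WW
  rw [Fin.prod_univ_succ, Fin.prod_univ_succ (f := fun b : Fin (n+1) =>
    U ((Fin.cons i0 i' : Fin (n+2) → Fin N) b.castSucc) ((Fin.cons i0 i' : Fin (n+2) → Fin N) b.succ))]
  simp only [Fin.cons_zero, Fin.cons_succ, Fin.castSucc_zero, Fin.tail]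
  have : ∀ b : Fin n, (Fin.cons i0 i' : Fin (n+2) → Fin N) b.succ.castSucc = i' b.castSucc := by
    intro b; rw [← Fin.succ_castSucc, Fin.cons_succ]
  simp only [this]
  ring

lemma rr_eq (n : ℕ) (z : Fin (n+1) → Fin N → ℝ) (i0 : Fin N) :
    rr U n z i0 = ∑ i' : Fin n → Fin N, WW U n z (Fin.cons i0 i') := by
  induction n generalizing i0 with
  | zero => simp [rr, WW]
  | succ n ih =>
    simp only [rr, WW_cons]
    rw [sum_consN, Finset.mul_sum]
    apply Finset.sum_congr rfl
    intro j _
    rw [ih, Finset.mul_sum, Finset.mul_sum]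
    rfl

lemma phi_eq (n : ℕ) (z : Fin (n+1) → Fin N → ℝ) :
    phiU N (n+1) U z = (1 / N) * ∑ i, rr U n z i := by
  unfold phiU
  simp_rw [rr_eq]
  rw [← sum_consN]
  rfl

variable {U}

lemma col_sq (hU : IsOrthogonal U) (r : Fin N → ℝ) : ∑ i, (∑ j, U i j * r j) ^ 2 = ∑ j, r j ^ 2 := by
  have : ∀ i, (∑ j, U i j * r j) ^ 2 = ∑ j, ∑ l, (U i j * U i l) * (r j * r l) := by
    intro i
    rw [sq, Finset.sum_mul_sum]
    apply Finset.sum_congr rfl; intro j _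
    apply Finset.sum_congr rfl; intro l _
    ring
  simp_rw [this]
  rw [Finset.sum_comm]
  apply Finset.sum_congr rfl; intro j _
  rw [Finset.sum_comm]
  simp_rw [← Finset.sum_mul, hU.1]
  simp [sq]

lemma rr_sq (hU : IsOrthogonal U) (n : ℕ) (z : Fin (n+1) → Fin N → Bool) :
    ∑ i, rr U n (fun a j => sg (z a j)) i ^ 2 = N := by
  induction n with
  | zero => simp [rr, sq, sg_sq]
  | succ n ih =>
    simp only [rr, mul_pow]
    simp only [sq (sg _), sg_sq, one_mul]
    rw [col_sq hU]
    exact ih (Fin.tail z)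

lemma phi_abs (hU : IsOrthogonal U) (n : ℕ) (z : Fin (n+1) → Fin N → Bool) :
    phiU N (n+1) U (fun a j => sg (z a j)) ≤ 1 := by
  rw [phi_eq]
  have h := sq_sum_le_card_mul_sum_sq (s := Finset.univ) (f := fun i => rr U n (fun a j => sg (z a j)) i)
  rw [rr_sq hU] at h
  simp only [Finset.card_univ, Fintype.card_fin] at h
  have h2 := abs_le_of_sq_le_sq' (a := ∑ i, rr U n (fun a j => sg (z a j)) i) (b := (N:ℝ)) (by rw [sq (N:ℝ)]; exact h) (Nat.cast_nonneg N)
  rcases Nat.eq_zero_or_pos N with h0 | h0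
  · subst h0; simp
  · have : (0:ℝ) < N := by exact_mod_cast h0
    rw [one_div, inv_mul_le_iff₀ this]; linarith [h2.2]

lemma E1_prod (g : Fin N → Bool → ℝ) (Z : Fin N → ℝ) :
    E1 (fun x => ∏ i, g i (x i)) Z = ∏ i, ∑ b : Bool, pf (some b) (Z i) * g i b := by
  unfold E1 PP
  simp_rw [← Finset.prod_mul_distrib]
  rw [Finset.prod_univ_sum, Fintype.piFinset_univ]

lemma E1_sg (i : Fin N) (Z : Fin N → ℝ) : E1 (fun x => sg (x i)) Z = Z i := by
  have h := E1_prod (fun j b => if j = i then sg b else 1) Z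
  have e : (fun x : Fin N → Bool => ∏ j, (if j = i then sg (x j) else 1)) = fun x => sg (x i) := by
    ext x; simp
  rw [e] at h
  rw [h, Finset.prod_eq_single i]
  · simp [pf, sg]; ring
  · intro j _ hj; simp [hj, pf, sg]; ring
  · simp

lemma E1_one (Z : Fin N → ℝ) : E1 (fun _ => 1) Z = 1 := by
  have h := E1_prod (fun _ _ => 1) Z
  simp only [Finset.prod_const_one] at h
  rw [h]
  apply Finset.prod_eq_one
  intro i _
  simp [pf, sg]; ring

lemma E1_sgsg (i j : Fin N) : E1 (fun x => sg (x i) * sg (x j)) (fun _ => 0) = if i = j then 1 else 0 := by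
  by_cases hij : i = j
  · subst hij; simp only [sg_sq, if_true]; exact E1_one _
  · rw [if_neg hij]
    have h := E1_prod (fun l b => if l = i ∨ l = j then sg b else 1) (fun _ : Fin N => 0)
    have e : (fun x : Fin N → Bool => ∏ l, (if l = i ∨ l = j then sg (x l) else 1)) = fun x => sg (x i) * sg (x j) := by
      ext x
      rw [← Finset.prod_filter]
      have : Finset.univ.filter (fun l => l = i ∨ l = j) = {i, j} := by ext l; simp
      rw [this, Finset.prod_pair hij]
    rw [e] at h
    rw [h]
    apply Finset.prod_eq_zero (Finset.mem_univ i)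
    simp [pf, sg]

lemma E1_sum {ι : Type*} (s : Finset ι) (c : ι → ℝ) (f : ι → (Fin N → Bool) → ℝ) (Z : Fin N → ℝ) :
    E1 (fun x => ∑ l ∈ s, c l * f l x) Z = ∑ l ∈ s, c l * E1 (f l) Z := by
  unfold E1
  simp_rw [Finset.mul_sum]
  rw [Finset.sum_comm]
  apply Finset.sum_congr rfl; intro l _
  apply Finset.sum_congr rfl; intro l _
  ring

variable (U) in
noncomputable def MM (i j : Fin N) : ℝ := U i j * ∫ v, kap (v i) * HH U v j ∂ppi N

variable (U) in
noncomputable def mm : ℕ → Fin N → ℝ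
  | 0, _ => rho
  | n+1, i => rho * ∑ j, MM U i j * mm n j

lemma MM_nonneg (i j : Fin N) : 0 ≤ MM U i j := by
  unfold MM
  have hkd := kapd_cont
  have hK := Kk_cont
  have hk := kap_cont
  have hH := HH_cont U
  have hY := YY_cont U
  have hd : ∀ (v : Fin N → ℝ) t, HasDerivAt (fun t => HH U (Function.update v i t) j)
      (kapd (YY U (Function.update v i t) j) * (U i j * kapd (Function.update v i t i))) t := by
    intro v t
    have hy : HasDerivAt (fun t => YY U (Function.update v i t) j) (U i j * kapd t) t := by
      unfold YY lin
      have e : (fun t : ℝ => ∑ l, U l j * kap (Function.update v i t l)) =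
          fun t => U i j * kap t + ∑ l ∈ Finset.univ.erase i, U l j * kap (v l) := by
        ext t
        rw [← Finset.add_sum_erase _ _ (Finset.mem_univ i)]
        congr 1
        · simp
        · apply Finset.sum_congr rfl
          intro j hj
          rw [Function.update_of_ne (Finset.ne_of_mem_erase hj)]
      rw [e]
      exact ((kap_deriv t).const_mul _).add_const _
    rw [Function.update_self]
    exact (kap_deriv _).comp t hy
  rw [ppi_ibp i (G' := fun v => kapd (YY U v j) * (U i j * kapd (v i))) (by fun_prop) (by fun_prop) hd]
  rw [← integral_const_mul]
  apply integral_nonneg_of_ae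
  filter_upwards [ppi_ae N] with v hv
  have h1 := Kk_nonneg (hv i)
  have h2 := kapd_nonneg (YY U v j)
  have h3 := kapd_nonneg (v i)
  have : U i j * (Kk (v i) * (kapd (YY U v j) * (U i j * kapd (v i)))) = (U i j)^2 * (Kk (v i) * (kapd (YY U v j) * kapd (v i))) := by ring
  rw [this]
  simp only [Pi.zero_apply]
  positivity

lemma MM_col (hU : IsOrthogonal U) (j : Fin N) : 0.548 ≤ ∑ i, MM U i j := by
  have hk := kap_cont
  have hH := HH_cont U
  have h := lin_kap (fun i => U i j) (by simpa [sq] using hU.1 j j)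
  refine h.trans (le_of_eq ?_)
  unfold MM
  simp_rw [← integral_const_mul]
  rw [← integral_finsetSum _ (fun i _ => ppi_integrable (by fun_prop))]
  congr 1
  ext v
  have : ∀ i, U i j * (kap (v i) * HH U v j) = (U i j * kap (v i)) * HH U v j := fun i => by ring
  simp_rw [this]
  rw [← Finset.sum_mul]
  rfl

lemma mm_nonneg (n : ℕ) (i : Fin N) : 0 ≤ mm U n i := by
  induction n generalizing i with
  | zero => simp [mm, rho]; norm_num
  | succ n ih =>
    rw [mm]
    apply mul_nonneg (by norm_num [rho])
    exact Finset.sum_nonneg (fun j _ => mul_nonneg (MM_nonneg i j) (ih j))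

lemma mm_sum (hU : IsOrthogonal U) (n : ℕ) : N * (rho * (rho * 0.548) ^ n) ≤ ∑ i, mm U n i := by
  induction n with
  | zero => simp [mm]
  | succ n ih =>
    simp only [mm]
    rw [← Finset.mul_sum, Finset.sum_comm]
    simp_rw [← Finset.sum_mul]
    have h1 : ∑ j, 0.548 * mm U n j ≤ ∑ j, (∑ i, MM U i j) * mm U n j :=
      Finset.sum_le_sum (fun j _ => mul_le_mul_of_nonneg_right (MM_col hU j) (mm_nonneg n j))
    rw [← Finset.mul_sum] at h1
    have h2 := mul_le_mul_of_nonneg_left ih (show (0:ℝ) ≤ rho * 0.548 by norm_num [rho])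
    have h3 := mul_le_mul_of_nonneg_left h1 (show (0:ℝ) ≤ rho by norm_num [rho])
    calc _ = rho * 0.548 * (N * (rho * (rho * 0.548) ^ n)) := by ring
      _ ≤ _ := h2
      _ ≤ _ := by linarith

lemma EE_mean (n : ℕ) (c : Fin N → ℝ) (Y : Fin N → ℝ) :
    EE U n (fun z => ∑ i, c i * rr U n (fun a j => sg (z a j)) i) Y = ∑ i, c i * (Y i * mm U n i) := by
  induction n generalizing c Y with
  | zero =>
    rw [EE_zero]
    simp only [rr]
    rw [E1_sum]
    apply Finset.sum_congr rfl; intro i _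
    rw [E1_sg, mm]; ring
  | succ n ih =>
    rw [EE_succ]
    have hk := kap_cont
    have hH := HH_cont U
    have e1 : ∀ (x : Fin N → Bool) (z : Fin (n+1) → Fin N → Bool),
        ∑ i, c i * rr U (n+1) (fun a j => sg ((Fin.cons x z : Fin (n+2) → Fin N → Bool) a j)) i =
        ∑ j, (∑ i, (c i * U i j) * sg (x i)) * rr U n (fun a j => sg (z a j)) j := by
      intro x z
      simp only [rr, Fin.cons_zero]
      simp_rw [Finset.sum_mul, Finset.mul_sum]
      rw [Finset.sum_comm]
      apply Finset.sum_congr rfl; intro j _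
      apply Finset.sum_congr rfl; intro i _
      have : (Fin.tail (fun a j => sg ((Fin.cons x z : Fin (n+2) → Fin N → Bool) a j))) = fun a j => sg (z a j) := rfl
      rw [this]; ring
    simp_rw [e1, ih]
    have e2 : ∀ v : Fin N → ℝ, E1 (fun x => ∑ j, (∑ i, (c i * U i j) * sg (x i)) * (HH U v j * mm U n j))
        (fun i => rho * (Y i * kap (v i))) = ∑ i, ∑ j, (c i * Y i * rho * U i j * mm U n j) * (kap (v i) * HH U v j) := by
      intro v
      have := E1_sum Finset.univ (fun j => HH U v j * mm U n j) (fun j x => ∑ i, (c i * U i j) * sg (x i)) (fun i => rho * (Y i * kap (v i)))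
      simp_rw [mul_comm _ (HH U v _ * mm U n _)]
      rw [this, Finset.sum_comm]
      apply Finset.sum_congr rfl; intro j _
      rw [E1_sum, Finset.mul_sum]
      apply Finset.sum_congr rfl; intro i _
      rw [E1_sg]; ring
    simp_rw [e2]
    rw [integral_finsetSum _ (fun i _ => ppi_integrable (by fun_prop))]
    apply Finset.sum_congr rfl; intro i _
    rw [integral_finsetSum _ (fun i _ => ppi_integrable (by fun_prop))]
    rw [mm, Finset.mul_sum, Finset.mul_sum, Finset.mul_sum]
    apply Finset.sum_congr rfl; intro j _
    rw [integral_const_mul, MM]; ring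

lemma yes_mean (hU : IsOrthogonal U) (hN : 0 < N) (n : ℕ) (hn : 1 ≤ n) :
    1 / 2 ^ n ≤ EE U n (fun z => phiU N (n+1) U (fun a j => sg (z a j))) (fun _ => 1) := by
  simp_rw [phi_eq, Finset.mul_sum]
  rw [EE_mean]
  rw [← Finset.mul_sum]
  simp only [one_mul]
  have h := mm_sum hU n
  have hN' : (0:ℝ) < N := by exact_mod_cast hN
  have h2 : rho * (rho * 0.548) ^ n ≤ 1 / N * ∑ i, mm U n i := by
    rw [one_div, le_inv_mul_iff₀ hN']; exact h
  refine le_trans ?_ h2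
  obtain ⟨m, rfl⟩ : ∃ m, n = m + 1 := ⟨n - 1, by omega⟩
  have h3 : ((1:ℝ)/2) ^ m ≤ (rho * 0.548) ^ m := by
    apply pow_le_pow_left₀ (by norm_num); norm_num [rho]
  rw [← one_div_pow, pow_succ, pow_succ]
  have : (1:ℝ)/2 ≤ rho * (rho * 0.548) := by norm_num [rho]
  have h4 : (0:ℝ) ≤ ((1:ℝ)/2)^m := by positivity
  nlinarith

lemma EE_smul (n : ℕ) (c : ℝ) (f : (Fin (n+1) → Fin N → Bool) → ℝ) (Y : Fin N → ℝ) :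
    EE U n (fun z => c * f z) Y = c * EE U n f Y := by
  unfold EE; rw [Finset.mul_sum]; apply Finset.sum_congr rfl; intros; ring

lemma EE_add (n : ℕ) (f g : (Fin (n+1) → Fin N → Bool) → ℝ) (Y : Fin N → ℝ) :
    EE U n (fun z => f z + g z) Y = EE U n f Y + EE U n g Y := by
  unfold EE; rw [← Finset.sum_add_distrib]; apply Finset.sum_congr rfl; intros; ring

lemma EE_mono (n : ℕ) {f g : (Fin (n+1) → Fin N → Bool) → ℝ} {Y : Fin N → ℝ} (hY : Y ∈ boxs N)
    (h : ∀ z, f z ≤ g z) : EE U n f Y ≤ EE U n g Y := by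
  unfold EE; exact Finset.sum_le_sum (fun z _ => mul_le_mul_of_nonneg_left (h z) (DD_nonneg U n hY z))

lemma EE_const (n : ℕ) (c : ℝ) (Y : Fin N → ℝ) : EE U n (fun _ => c) Y = c := by
  have := EE_smul (U := U) n c (fun _ => 1) Y
  simpa [EE_one] using this

lemma EE_sum {Ω : Type*} (s : Finset Ω) (w : Ω → ℝ) (n : ℕ) (f : Ω → (Fin (n+1) → Fin N → Bool) → ℝ) (Y : Fin N → ℝ) :
    EE U n (fun z => ∑ ω ∈ s, w ω * f ω z) Y = ∑ ω ∈ s, w ω * EE U n (f ω) Y := by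
  unfold EE
  simp_rw [Finset.mul_sum]
  rw [Finset.sum_comm]
  apply Finset.sum_congr rfl; intro l _
  apply Finset.sum_congr rfl; intro l _
  ring

lemma no_second (hU : IsOrthogonal U) (hN : 0 < N) (n : ℕ) (hn : 1 ≤ n) :
    EE U n (fun z => phiU N (n+1) U (fun a j => sg (z a j)) ^ 2) (fun _ => 0) = 1 / N := by
  obtain ⟨m, rfl⟩ : ∃ m, n = m + 1 := ⟨n - 1, by omega⟩
  have hN' : (N:ℝ) ≠ 0 := by positivity
  simp_rw [phi_eq, mul_pow]
  rw [EE_smul]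
  suffices h : EE U (m+1) (fun z => (∑ i, rr U (m+1) (fun a j => sg (z a j)) i) ^ 2) (fun _ => 0) = N by
    rw [h]; field_simp
  rw [EE_succ]
  have key : ∀ v : Fin N → ℝ, E1 (fun x => EE U m (fun z => (∑ i, rr U (m+1) (fun a j => sg ((Fin.cons x z : Fin (m+2) → Fin N → Bool) a j)) i) ^ 2) (HH U v))
      (fun i => rho * (0 * kap (v i))) = N := by
    intro v
    simp only [zero_mul, mul_zero]
    unfold EE
    rw [E1_sum]
    have : ∀ z : Fin (m+1) → Fin N → Bool, E1 (fun x => (∑ i, rr U (m+1) (fun a j => sg ((Fin.cons x z : Fin (m+2) → Fin N → Bool) a j)) i) ^ 2) (fun _ => 0) = N := by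
      intro z
      set r := rr U m (fun a j => sg (z a j)) with hr
      have e : ∀ x, (∑ i, rr U (m+1) (fun a j => sg ((Fin.cons x z : Fin (m+2) → Fin N → Bool) a j)) i) ^ 2 =
          ∑ i, ∑ l, ((∑ j, U i j * r j) * (∑ j, U l j * r j)) * (sg (x i) * sg (x l)) := by
        intro x
        rw [sq, Finset.sum_mul_sum]
        apply Finset.sum_congr rfl; intro i _
        apply Finset.sum_congr rfl; intro l _
        simp only [rr, Fin.cons_zero]
        have : (Fin.tail (fun a j => sg ((Fin.cons x z : Fin (m+2) → Fin N → Bool) a j))) = fun a j => sg (z a j) := rfl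
        rw [this, ← hr]; ring
      simp_rw [e]
      simp_rw [← Fintype.sum_prod_type']
      rw [E1_sum Finset.univ (fun p : Fin N × Fin N => (∑ j, U p.1 j * r j) * (∑ j, U p.2 j * r j)) (fun p x => sg (x p.1) * sg (x p.2))]
      simp_rw [E1_sgsg]
      rw [Fintype.sum_prod_type]
      simp only [mul_ite, mul_one, mul_zero, Finset.sum_ite_eq, Finset.mem_univ, if_true]
      simp_rw [← sq]
      rw [col_sq hU, hr, rr_sq hU]
    simp_rw [this]
    have h1 := EE_const (U := U) m N (HH U v)
    exact h1
  simp_rw [key]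
  simp

end phifacts
end Ror


namespace Ror

section amplify
variable {α : Type}

def bd : DTree α → (Bool → DTree α) → DTree α
  | .leaf b, f => f b
  | .node i t0 t1, f => .node i (bd t0 f) (bd t1 f)

lemma bd_eval (t : DTree α) (f : Bool → DTree α) (x : α → Bool) :
    (bd t f).eval x = t.eval x * (f true).eval x + (1 - t.eval x) * (f false).eval x := by
  induction t with
  | leaf b => cases b <;> simp [bd, DTree.eval]
  | node i t0 t1 h0 h1 =>
    simp only [bd, DTree.eval]
    split_ifs
    · exact h1
    · exact h0

lemma bd_depth (t : DTree α) (f : Bool → DTree α) (D : ℕ) (hf : ∀ b, (f b).depth ≤ D) :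
    (bd t f).depth ≤ t.depth + D := by
  induction t with
  | leaf b => simpa [bd, DTree.depth] using hf b
  | node i t0 t1 h0 h1 =>
    simp only [bd, DTree.depth]
    omega

def maj3 (t1 t2 t3 : DTree α) : DTree α :=
  bd t1 (fun b => bd t2 (fun c => if b = c then .leaf b else t3))

lemma maj3_eval (t1 t2 t3 : DTree α) (x : α → Bool) : (maj3 t1 t2 t3).eval x =
    t1.eval x * (t2.eval x + (1 - t2.eval x) * t3.eval x) + (1 - t1.eval x) * (t2.eval x * t3.eval x) := by
  simp [maj3, bd_eval, DTree.eval]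

lemma maj3_depth {t1 t2 t3 : DTree α} {d : ℕ} (h1 : t1.depth ≤ d) (h2 : t2.depth ≤ d) (h3 : t3.depth ≤ d) :
    (maj3 t1 t2 t3).depth ≤ 3 * d := by
  unfold maj3
  refine (bd_depth _ _ (2*d) (fun b => (bd_depth _ _ d (fun c => ?_)).trans ?_)).trans ?_
  · split_ifs
    · simp [DTree.depth]
    · exact h3
  · omega
  · omega

/-- `q` is the acceptance probability function of a randomized tree of depth at most `d` -/
def RT (d : ℕ) (q : (α → Bool) → ℝ) : Prop :=
  ∃ (Ω : Type) (_ : Fintype Ω) (w : Ω → ℝ) (T : Ω → DTree α), (∀ ω, 0 ≤ w ω) ∧ ∑ ω, w ω = 1 ∧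
    (∀ ω, (T ω).depth ≤ d) ∧ ∀ x, q x = ∑ ω, w ω * (T ω).eval x

def ff (p : ℝ) : ℝ := p ^ 2 * (3 - 2 * p)

lemma RT_step {d : ℕ} {q : (α → Bool) → ℝ} (h : RT d q) : RT (3 * d) (fun x => ff (q x)) := by
  obtain ⟨Ω, _, w, T, h0, h1, hd, hq⟩ := h
  refine ⟨Ω × Ω × Ω, inferInstance, fun o => w o.1 * (w o.2.1 * w o.2.2), fun o => maj3 (T o.1) (T o.2.1) (T o.2.2),
    fun o => mul_nonneg (h0 _) (mul_nonneg (h0 _) (h0 _)), ?_, fun o => maj3_depth (hd _) (hd _) (hd _), ?_⟩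
  · simp_rw [Fintype.sum_prod_type, ← Finset.mul_sum, h1, mul_one]
    rw [h1]; simpa using h1
  · intro x
    have tri : ∀ f g h : Ω → ℝ, ∑ o : Ω × Ω × Ω, f o.1 * (g o.2.1 * h o.2.2) = (∑ a, f a) * ((∑ a, g a) * ∑ a, h a) := by
      intro f g h
      simp_rw [Fintype.sum_prod_type, ← Finset.mul_sum, ← Finset.sum_mul]
    have e : ∀ o : Ω × Ω × Ω, w o.1 * (w o.2.1 * w o.2.2) * (maj3 (T o.1) (T o.2.1) (T o.2.2)).eval x =
      (w o.1 * (T o.1).eval x) * ((w o.2.1 * (T o.2.1).eval x) * w o.2.2) +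
      (w o.1 * (T o.1).eval x) * (w o.2.1 * (w o.2.2 * (T o.2.2).eval x)) +
      w o.1 * ((w o.2.1 * (T o.2.1).eval x) * (w o.2.2 * (T o.2.2).eval x)) -
      2 * ((w o.1 * (T o.1).eval x) * ((w o.2.1 * (T o.2.1).eval x) * (w o.2.2 * (T o.2.2).eval x))) := by
      intro o; rw [maj3_eval]; ring
    simp_rw [e]
    rw [Finset.sum_sub_distrib, Finset.sum_add_distrib, Finset.sum_add_distrib, ← Finset.mul_sum,
      tri (fun a => w a * (T a).eval x) (fun a => w a * (T a).eval x) w,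
      tri (fun a => w a * (T a).eval x) w (fun a => w a * (T a).eval x),
      tri w (fun a => w a * (T a).eval x) (fun a => w a * (T a).eval x),
      tri (fun a => w a * (T a).eval x) (fun a => w a * (T a).eval x) (fun a => w a * (T a).eval x), h1, ← hq, ff]
    ring

lemma RT_iter {d : ℕ} {q : (α → Bool) → ℝ} (h : RT d q) (t : ℕ) : RT (3 ^ t * d) (fun x => ff^[t] (q x)) := by
  induction t with
  | zero => simpa using h
  | succ t ih =>
    have := RT_step ih
    simp_rw [Function.iterate_succ_apply']
    convert this using 1
    ring

lemma ff_one_sub (p : ℝ) : ff (1 - p) = 1 - ff p := by unfold ff; ring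

lemma ff_iter_one_sub (p : ℝ) (t : ℕ) : ff^[t] (1 - p) = 1 - ff^[t] p := by
  induction t with
  | zero => simp
  | succ t ih => rw [Function.iterate_succ_apply', ih, ff_one_sub, Function.iterate_succ_apply']

lemma ff_iter {p : ℝ} (h0 : 0 ≤ p) (h1 : p ≤ 1/3) (t : ℕ) :
    0 ≤ ff^[t+1] p ∧ 3 * ff^[t+1] p ≤ (7/9) ^ (2 ^ t) := by
  induction t with
  | zero =>
    simp only [zero_add, Function.iterate_one, pow_zero, pow_one]
    unfold ff
    constructor
    · apply mul_nonneg (sq_nonneg _); linarith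
    · nlinarith [mul_nonneg h0 (sub_nonneg.2 h1), mul_nonneg (mul_nonneg h0 h0) (sub_nonneg.2 h1)]
  | succ t ih =>
    rw [Function.iterate_succ_apply']
    obtain ⟨i1, i2⟩ := ih
    set r := ff^[t+1] p
    have hle : ((7:ℝ)/9) ^ (2^t) ≤ 1 := pow_le_one₀ (by norm_num) (by norm_num)
    constructor
    · unfold ff; apply mul_nonneg (sq_nonneg _); linarith
    · calc 3 * ff r ≤ (3 * r) ^ 2 := by unfold ff; nlinarith [pow_nonneg i1 3]
        _ ≤ ((7/9) ^ (2^t)) ^ 2 := pow_le_pow_left₀ (by linarith) i2 2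
        _ = _ := by rw [← pow_mul, pow_succ]

lemma RT_range {d : ℕ} {q : (α → Bool) → ℝ} (h : RT d q) (x : α → Bool) : 0 ≤ q x ∧ q x ≤ 1 := by
  obtain ⟨Ω, _, w, T, h0, h1, hd, hq⟩ := h
  have ev : ∀ t : DTree α, 0 ≤ t.eval x ∧ t.eval x ≤ 1 := by
    intro t
    induction t with
    | leaf b => cases b <;> simp [DTree.eval]
    | node i t0 t1 h0 h1 => simp only [DTree.eval]; split_ifs <;> assumption
  rw [hq]
  constructor
  · exact Finset.sum_nonneg (fun ω _ => mul_nonneg (h0 ω) (ev _).1)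
  · rw [← h1]
    exact Finset.sum_le_sum (fun ω _ => mul_le_of_le_one_right (h0 ω) (ev _).2)

lemma RT_mono {d d' : ℕ} (hdd : d ≤ d') {q : (α → Bool) → ℝ} (h : RT d q) : RT d' q := by
  obtain ⟨Ω, i, w, T, h0, h1, hd, hq⟩ := h
  exact ⟨Ω, i, w, T, h0, h1, fun ω => (hd ω).trans hdd, hq⟩

lemma RT_amp {d k : ℕ} (hk : 2 ≤ k) {q : (α → Bool) → ℝ} (h : RT d q) :
    ∃ q' : (α → Bool) → ℝ, RT (324 * k ^ 2 * d) q' ∧ (∀ x, 2/3 ≤ q x → 1 - (1/2)^k / 6 ≤ q' x) ∧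
      (∀ x, q x ≤ 1/3 → q' x ≤ (1/2)^k / 6) := by
  set t := Nat.clog 2 (3 * (k+1)) with ht
  have t1 : 3 * (k+1) ≤ 2 ^ t := Nat.le_pow_clog (by norm_num) _
  have t2 : 2 ^ t < 6 * (k+1) := by
    have := Nat.pow_pred_clog_lt_self (b := 2) (by norm_num) (x := 3 * (k+1)) (by omega)
    rw [← ht] at this
    have ht0 : 0 < t := Nat.clog_pos (by norm_num) (by omega)
    obtain ⟨s, hs⟩ : ∃ s, t = s + 1 := ⟨t - 1, by omega⟩
    rw [hs] at this ⊢
    simp only [Nat.pred_succ] at this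
    rw [pow_succ]; omega
  have key : ∀ p : ℝ, 0 ≤ p → p ≤ 1/3 → ff^[t+1] p ≤ (1/2)^k / 6 := by
    intro p h0 h1
    have := (ff_iter h0 h1 t).2
    have h2 : ((7:ℝ)/9) ^ (2^t) ≤ (7/9) ^ (3 * (k+1)) := pow_le_pow_of_le_one (by norm_num) (by norm_num) t1
    have h3 : ((7:ℝ)/9) ^ (3 * (k+1)) ≤ (1/2) ^ (k+1) := by
      rw [pow_mul]; exact pow_le_pow_left₀ (by norm_num) (by norm_num) _
    rw [pow_succ] at h3
    linarith
  refine ⟨fun x => ff^[t+1] (q x), RT_mono ?_ (RT_iter h (t+1)), ?_, ?_⟩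
  · apply Nat.mul_le_mul_right
    calc 3 ^ (t+1) ≤ 4 ^ (t+1) := Nat.pow_le_pow_left (by norm_num) _
      _ = 4 * (2 ^ t) ^ 2 := by rw [← pow_mul, mul_comm t 2, pow_mul, pow_succ]; norm_num; ring
      _ ≤ 4 * (9 * k) ^ 2 := by gcongr; omega
      _ = _ := by ring
  · intro x hx
    have := key (1 - q x) (by linarith [(RT_range h x).2]) (by linarith)
    rw [ff_iter_one_sub] at this
    linarith
  · intro x hx
    exact key _ (RT_range h x).1 hx

end amplify
end Ror


namespace Ror

section final
variable {N : ℕ} {U : Fin N → Fin N → ℝ}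

lemma gap (hU : IsOrthogonal U) {n : ℕ} (hn : 1 ≤ n) (hN : 16 * 8 ^ (n+1) ≤ N)
    {q : (Fin (n+1) → Fin N → Bool) → ℝ} (hq1 : ∀ z, 0 ≤ q z ∧ q z ≤ 1)
    (hy : ∀ z, (1:ℝ) / 2 ^ (n+1) ≤ phiU N (n+1) U (fun a j => sg (z a j)) → 1 - (1/2)^(n+1) / 6 ≤ q z)
    (hno : ∀ z, |phiU N (n+1) U (fun a j => sg (z a j))| ≤ (1:ℝ) / 2 ^ (n+2) → q z ≤ (1/2)^(n+1) / 6) :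
    (23/24) * (1/2)^(n+1) ≤ EE U n q (fun _ => 1) ∧ EE U n q (fun _ => 0) ≤ (5/12) * (1/2)^(n+1) := by
  have h8 : 0 < 8 ^ (n+1) := by positivity
  have hN0 : 0 < N := by omega
  have hN' : (0:ℝ) < N := by exact_mod_cast hN0
  set τ : ℝ := (1/2)^(n+1) with hτ
  have hτ0 : 0 < τ := by positivity
  have hτ4 : τ ≤ 1/4 := by
    calc τ ≤ (1/2)^2 := pow_le_pow_of_le_one (by norm_num) (by norm_num) (by omega)
      _ = 1/4 := by norm_num
  have e1 : (1:ℝ) / 2 ^ (n+1) = τ := by rw [hτ, one_div_pow]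
  have e2 : (1:ℝ) / 2 ^ (n+2) = τ / 2 := by rw [hτ, ← one_div_pow]; ring
  have e3 : (1:ℝ) / 2 ^ n = 2 * τ := by rw [hτ, ← one_div_pow]; ring
  rw [e1] at hy
  rw [e2] at hno
  constructor
  · have h1 : EE U n (fun z => (23/24) * (phiU N (n+1) U (fun a j => sg (z a j)) + (-τ))) (fun _ => 1) ≤ EE U n q (fun _ => 1) := by
      apply EE_mono n (sbox (by norm_num) (by norm_num))
      intro z
      have hp := phi_abs hU n z
      by_cases h : τ ≤ phiU N (n+1) U (fun a j => sg (z a j))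
      · have := hy z h
        linarith
      · have := (hq1 z).1
        push Not at h
        linarith
    rw [EE_smul, EE_add, EE_const] at h1
    have := yes_mean hU hN0 n hn
    rw [e3] at this
    linarith
  · have h1 : EE U n q (fun _ => 0) ≤ EE U n (fun z => τ/6 + (4/τ^2) * (phiU N (n+1) U (fun a j => sg (z a j)))^2) (fun _ => 0) := by
      apply EE_mono n (sbox (by norm_num) (by norm_num))
      intro z
      by_cases h : |phiU N (n+1) U (fun a j => sg (z a j))| ≤ τ/2
      · have := hno z h
        have : 0 ≤ (4/τ^2) * (phiU N (n+1) U (fun a j => sg (z a j)))^2 := by positivity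
        linarith
      · push Not at h
        have h2 : (τ/2)^2 ≤ (phiU N (n+1) U (fun a j => sg (z a j)))^2 := by
          rw [← sq_abs (phiU _ _ _ _)]
          exact pow_le_pow_left₀ (by positivity) h.le 2
        have h3 : 1 ≤ (4/τ^2) * (phiU N (n+1) U (fun a j => sg (z a j)))^2 := by
          calc (1:ℝ) = (4/τ^2) * (τ/2)^2 := by field_simp; norm_num
            _ ≤ _ := mul_le_mul_of_nonneg_left h2 (by positivity)
        linarith [(hq1 z).2]
    rw [EE_add, EE_smul, EE_const, no_second hU hN0 n hn] at h1
    have h4 : (4/τ^2) * (1/N) ≤ τ/4 := by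
      have h5 : 16 ≤ τ^3 * N := by
        have : (16 * 8 ^ (n+1) : ℝ) ≤ N := by exact_mod_cast hN
        have e : τ ^ 3 * 8 ^ (n+1) = 1 := by
          rw [hτ, ← pow_mul, mul_comm (n+1) 3, pow_mul, ← mul_pow]; norm_num
        calc (16:ℝ) = τ^3 * (16 * 8 ^ (n+1)) := by linear_combination (-16) * e
          _ ≤ _ := mul_le_mul_of_nonneg_left this (by positivity)
      rw [div_mul_div_comm, div_le_div_iff₀ (by positivity) (by norm_num)]
      nlinarith
    linarith

lemma num_three {m d : ℕ} {c y L l : ℝ} (hc0 : 0 < c) (hc : c ≤ 1 / 10 ^ 17) (hy : 2 ≤ y) (hL : 1 ≤ L) (hl0 : 0 ≤ l) (hl : l ≤ L)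
    (hd : d * ((m + 3) * L) ≤ c * y ^ (2 * (m+2))) :
    25 * (324 * (m+3:ℝ)^2 * d) * (250000 * √(100 * (324 * (m+3:ℝ)^2 * d) * l / y ^ (3 * (m+2) + 2))) ^ (m+2) ≤ 1/2 := by
  have hy0 : 0 < y := by linarith
  set D : ℝ := 324 * (m+3:ℝ)^2 * d with hD
  have hD0 : 0 ≤ D := by positivity
  set B : ℝ := 324 * c * (m+3) * y ^ (2 * (m+2)) with hB
  have hDL : D * L ≤ B := by
    have := mul_le_mul_of_nonneg_left hd (show (0:ℝ) ≤ 324 * (m+3) by positivity)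
    calc D * L = 324 * (m+3) * (d * ((m + 3) * L)) := by rw [hD]; ring
      _ ≤ _ := this
      _ = B := by rw [hB]; ring
  have hDB : D ≤ B := by nlinarith
  have hDl : D * l ≤ B := by nlinarith
  have hB0 : 0 ≤ B := by positivity
  apply abs_le_of_sq_le_sq' _ (by norm_num) |>.2
  set X := 100 * D * l / y ^ (3 * (m+2) + 2) with hX
  have hX0 : 0 ≤ X := by positivity
  have hXB : X ≤ 100 * B / y ^ (3 * (m+2) + 2) := by
    apply div_le_div_of_nonneg_right _ (by positivity)
    nlinarith
  have e : (25 * D * (250000 * √X) ^ (m+2)) ^ 2 = 625 * D ^ 2 * (250000 ^ 2 * X) ^ (m+2) := by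
    have : (25 * D * (250000 * √X) ^ (m+2)) ^ 2 = 625 * D ^ 2 * (250000 ^ 2 * √X ^ 2) ^ (m+2) := by
      rw [← mul_pow, mul_pow _ _ 2, mul_pow 25 D 2, pow_right_comm]; norm_num
    rw [this, Real.sq_sqrt hX0]
  rw [e]
  have hm : (m + 3 : ℝ) ≤ 2 ^ (m+2) := by
    have : m + 3 ≤ 2 ^ (m+2) := Nat.lt_two_pow_self (n := m+2)
    exact_mod_cast this
  have ypow : y ^ (2 * (m+2) * (m+4)) * 2 ^ (m * (m+2)) ≤ y ^ ((3 * (m+2) + 2) * (m+2)) := by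
    calc _ ≤ y ^ (2 * (m+2) * (m+4)) * y ^ (m * (m+2)) := by gcongr
      _ = _ := by rw [← pow_add]; congr 1; ring
  have hkp : (m + 3 : ℝ) ^ (m+4) ≤ 2 ^ (m * (m+2)) * 16 ^ (m+2) := by
    calc (m + 3 : ℝ) ^ (m+4) ≤ (2 ^ (m+2)) ^ (m+4) := pow_le_pow_left₀ (by positivity) hm _
      _ = 2 ^ (m * (m+2)) * 16 ^ (m+2) := by
        rw [show (16:ℝ) = 2^4 by norm_num, ← pow_mul, ← pow_mul, ← pow_add]; congr 1; ring
  calc 625 * D ^ 2 * (250000 ^ 2 * X) ^ (m+2)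
      ≤ 625 * B ^ 2 * (250000 ^ 2 * (100 * B / y ^ (3 * (m+2) + 2))) ^ (m+2) := by gcongr
    _ = 625 * (250000 ^ 2 * 100) ^ (m+2) * (324 * c) ^ (m+4) * ((m+3:ℝ) ^ (m+4) * y ^ (2 * (m+2) * (m+4)) / y ^ ((3 * (m+2) + 2) * (m+2))) := by
        have : B ^ 2 * B ^ (m+2) = (324 * c) ^ (m+4) * ((m+3:ℝ) ^ (m+4) * y ^ (2 * (m+2) * (m+4))) := by
          rw [← pow_add, hB, pow_mul y (2 * (m+2)), ← mul_pow, ← mul_pow]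
          rw [show 2 + (m+2) = m + 4 by ring]; congr 1; ring
        rw [pow_mul y (3 * (m+2) + 2)]
        calc _ = 625 * (250000 ^ 2 * 100) ^ (m+2) * (B^2 * B ^ (m+2)) / (y ^ (3 * (m+2) + 2)) ^ (m+2) := by
              rw [← mul_div_assoc, div_pow, ← mul_assoc, mul_pow _ B]; ring
          _ = _ := by rw [this]; ring
    _ ≤ 625 * (250000 ^ 2 * 100) ^ (m+2) * (324 * c) ^ (m+4) * 16 ^ (m+2) := by
        apply mul_le_mul_of_nonneg_left _ (by positivity)
        rw [div_le_iff₀ (by positivity)]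
        calc _ ≤ (2 ^ (m * (m+2)) * 16 ^ (m+2)) * y ^ (2 * (m+2) * (m+4)) := by gcongr
          _ = 16 ^ (m+2) * (y ^ (2 * (m+2) * (m+4)) * 2 ^ (m * (m+2))) := by ring
          _ ≤ _ := by gcongr
    _ = 625 * (324 * c) ^ 2 * (250000 ^ 2 * 100 * 16 * (324 * c)) ^ (m+2) := by
        rw [show m + 4 = 2 + (m+2) by ring, pow_add (324*c), mul_pow _ (324*c), mul_pow _ (16:ℝ)]; ring
    _ ≤ 625 * (1/50) ^ 2 * 1 ^ (m+2) := by
        gcongr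
        · linarith
        · linarith
    _ ≤ (1/2)^2 := by rw [one_pow]; norm_num

lemma num_two {d : ℕ} {c y L l : ℝ} (hc0 : 0 < c) (hc : c ≤ 1 / 10 ^ 17) (hy : 2 ≤ y) (hL : 1 ≤ L) (hl0 : 0 ≤ l) (hl : l ≤ L)
    (hd : d * (2 * L) ≤ c * y ^ 2) :
    2 * (2500 ^ 4 * (√(100 * (324 * 2^2 * d) * l / y ^ 5) ^ 2 * (324 * 2^2 * d))) ≤ (1/10:ℝ)^2 := by
  have hy0 : 0 < y := by linarith
  rw [Real.sq_sqrt (by positivity)]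
  have hd0 : (0:ℝ) ≤ d := Nat.cast_nonneg d
  have h1 : (d:ℝ) ≤ c * y^2 := by nlinarith
  have h2 : (d:ℝ) * l ≤ c * y^2 := by nlinarith
  have h3 : (d:ℝ) * l * d ≤ c * y^2 * (c * y^2) := by gcongr
  have h4 : (d:ℝ) * l * d / y^5 ≤ c^2 := by
    rw [div_le_iff₀ (by positivity)]
    have : c^2 * y^4 * 1 ≤ c^2 * y^4 * y := by gcongr; linarith
    nlinarith
  have h5 : c^2 ≤ (1/10^17)^2 := by gcongr
  calc _ = 2 * 2500^4 * 100 * (324*2^2)^2 * ((d:ℝ) * l * d / y^5) := by ring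
    _ ≤ 2 * 2500^4 * 100 * (324*2^2)^2 * (1/10^17)^2 := by gcongr; linarith
    _ ≤ _ := by norm_num

end final
end Ror
open Ror
theorem rorrelation_randomized_lower_bound :
    ∃ c : ℝ, 0 < c ∧
      ∀ (N k d : ℕ), 2 ≤ k → 16 * 8 ^ k ≤ N →
        ∀ U : Fin N → Fin N → ℝ, IsOrthogonal U → IsGood U →
          ∀ (Ω : Type) (_ : Fintype Ω) (w : Ω → ℝ)
            (T : Ω → DTree (Fin k × Fin N)),
            (∀ ω, 0 ≤ w ω) → (∑ ω, w ω) = 1 → (∀ ω, (T ω).depth ≤ d) →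
            (∀ z : Fin k → Fin N → Bool,
              (1 : ℝ) / 2 ^ k ≤ phiU N k U (fun a j => if z a j then 1 else -1) →
              (2 : ℝ) / 3 ≤ ∑ ω, w ω * (T ω).eval (fun p => z p.1 p.2)) →
            (∀ z : Fin k → Fin N → Bool,
              |phiU N k U (fun a j => if z a j then 1 else -1)| ≤
                  (1 : ℝ) / 2 ^ (k + 1) →
              (2 : ℝ) / 3 ≤ ∑ ω, w ω * (1 - (T ω).eval (fun p => z p.1 p.2))) →
            c * (N : ℝ) ^ ((2 * ((k : ℝ) - 1)) / (3 * (k : ℝ) - 1)) /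
                (k * Real.log (k * N)) ≤ d := by
  refine ⟨1 / 10 ^ 17, by norm_num, ?_⟩
  intro N k d hk hN U hU hG Ω _ w T hw0 hw1 hTd hyes hno
  by_contra hcon
  push Not at hcon
  obtain ⟨n, rfl⟩ : ∃ n, k = n + 1 := ⟨k - 1, by omega⟩
  have hn : 1 ≤ n := by omega
  have h8 : 0 < 8 ^ (n+1) := by positivity
  have hN0 : 0 < N := by omega
  have hNr : (0:ℝ) < N := by exact_mod_cast hN0
  have hN1 : (1:ℝ) ≤ N := by exact_mod_cast hN0
  set L := Real.log (((n+1 : ℕ):ℝ) * N) with hL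
  have hLN : Real.log N ≤ L := by
    apply Real.log_le_log hNr
    have : (1:ℝ) ≤ ((n+1:ℕ):ℝ) := by exact_mod_cast (by omega : 1 ≤ n+1)
    nlinarith
  have hLN1 : 1 ≤ Real.log N := by
    rw [Real.le_log_iff_exp_le hNr]
    have : (16:ℝ) ≤ N := by
      have : 16 ≤ N := by omega
      exact_mod_cast this
    linarith [Real.exp_one_lt_d9]
  have hL1 : 1 ≤ L := hLN1.trans hLN
  set y : ℝ := (N:ℝ) ^ ((1:ℝ) / ((3 * n + 2 : ℕ):ℝ)) with hy
  have hy0 : 0 < y := by positivity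
  have hyN : y ^ (3 * n + 2) = N := by
    rw [hy, ← Real.rpow_natCast, ← Real.rpow_mul hNr.le]
    rw [one_div_mul_cancel (by positivity), Real.rpow_one]
  have hye : (N : ℝ) ^ ((2 * (((n+1:ℕ) : ℝ) - 1)) / (3 * ((n+1:ℕ) : ℝ) - 1)) = y ^ (2 * n) := by
    rw [hy, ← Real.rpow_natCast, ← Real.rpow_mul hNr.le]
    congr 1
    push_cast
    have : (3 * (n:ℝ) + 2) ≠ 0 := by positivity
    have e : 3 * ((n:ℝ) + 1) - 1 = 3 * n + 2 := by ring
    rw [e]; field_simp; ring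
  have hy2 : 2 ≤ y := by
    apply le_of_pow_le_pow_left₀ (n := 3 * n + 2) (by omega) hy0.le
    rw [hyN]
    have : (16 * 8 ^ (n+1) : ℝ) ≤ N := by exact_mod_cast hN
    refine le_trans ?_ this
    have e : (8:ℝ)^(n+1) = 2 ^ (3 * n + 2) * 2 := by
      rw [show (8:ℝ) = 2^3 by norm_num, ← pow_mul, ← pow_succ]; congr 1
    rw [e]
    have : (0:ℝ) < 2 ^ (3*n+2) := by positivity
    linarith
  rw [hye] at hcon
  have hn1 : (0:ℝ) < ((n+1:ℕ):ℝ) := by positivity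
  rw [lt_div_iff₀ (by positivity)] at hcon
  have hRT : RT d (fun x => ∑ ω, w ω * (T ω).eval x) := ⟨Ω, inferInstance, w, T, hw0, hw1, hTd, fun _ => rfl⟩
  obtain ⟨q', hq', hqy, hqn⟩ := RT_amp hk hRT
  set q : (Fin (n+1) → Fin N → Bool) → ℝ := fun z => q' (fun p => z p.1 p.2) with hq
  obtain ⟨g1, g2⟩ := gap (q := q) hU hn hN (fun z => RT_range hq' _) (fun z hz => hqy _ (hyes z hz)) (fun z hz => hqn _ (by
    have := hno z hz
    simp_rw [mul_sub, mul_one] at this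
    rw [Finset.sum_sub_distrib, hw1] at this
    linarith))
  obtain ⟨Ω', _, w', T', h0', h1', hd', hqq⟩ := hq'
  have eq : q = fun z => ∑ ω, w' ω * (T' ω).eval (fun p => z p.1 p.2) := by
    ext z; exact hqq _
  rw [eq, EE_sum _ w' n (fun ω z => (T' ω).eval (fun p => z p.1 p.2))] at g1 g2
  set D := 324 * (n+1)^2 * d with hD
  have hBil := good_bil hG D
  set δ := √(100 * D * Real.log N / N) with hδ
  have hδ0 : 0 ≤ δ := Real.sqrt_nonneg _
  have hτ : (0:ℝ) < (1/2)^(n+1) := by positivity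
  rcases Nat.lt_or_ge n 2 with h | h
  · have hn1 : n = 1 := by omega
    subst hn1
    have hKD : 2 * (2500 ^ 4 * (δ ^ 2 * D)) ≤ (1/10:ℝ) ^ 2 := by
      have := num_two (d := d) (c := 1/10^17) (by norm_num) le_rfl hy2 hL1 (by linarith) hLN (by
        have := hcon.le
        norm_num at this ⊢
        exact this)
      rw [show (5:ℕ) = 3 * 1 + 2 by norm_num, hyN] at this
      rw [hδ, hD]
      push_cast
      norm_num at this ⊢
      exact this
    have := Finset.sum_le_sum (fun ω (_ : ω ∈ Finset.univ) => mul_le_mul_of_nonneg_left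
      (tree_two (K := 1/10) (by norm_num) hδ0 hBil hKD (T' ω) (hd' ω)) (h0' ω))
    simp_rw [mul_add] at this
    rw [Finset.sum_add_distrib, ← Finset.sum_mul, h1'] at this
    norm_num at g1 g2
    linarith
  · obtain ⟨m, rfl⟩ : ∃ m, n = m + 2 := ⟨n - 2, by omega⟩
    have hε : 25 * D * (250000 * δ) ^ (m+2) ≤ 1/2 := by
      have := num_three (d := d) (m := m) (c := 1/10^17) (by norm_num) le_rfl hy2 hL1 (by linarith) hLN (by
        have := hcon.le
        push_cast at this
        rw [show (m:ℝ) + 2 + 1 = m + 3 by ring] at this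
        exact this)
      rw [hyN] at this
      rw [hδ, hD]
      push_cast
      rw [show (m:ℝ) + 2 + 1 = m + 3 by ring]
      exact this
    have h1 : Real.exp (25 * D * (250000 * δ) ^ (m+2)) ≤ 2 := by
      refine (Real.exp_le_exp.2 hε).trans ?_
      have h2 : Real.exp (1/2) ^ 2 ≤ 2 ^ 2 := by
        rw [← Real.exp_nat_mul]; norm_num
        linarith [Real.exp_one_lt_d9]
      exact (abs_le_of_sq_le_sq' h2 (by norm_num)).2
    have := Finset.sum_le_sum (fun ω (_ : ω ∈ Finset.univ) => mul_le_mul_of_nonneg_left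
      (tree_mult U hδ0 hBil (m+2) (T' ω) (hd' ω)) (h0' ω))
    simp_rw [mul_left_comm (w' _)] at this
    rw [← Finset.mul_sum] at this
    have h3 := mul_le_mul_of_nonneg_left g2 (Real.exp_nonneg (25 * D * (250000 * δ) ^ (m+2)))
    have h4 := mul_le_mul_of_nonneg_right h1 (show (0:ℝ) ≤ 5/12 * (1/2)^(m+2+1) by positivity)
    linarith
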